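/- arXiv:2201.05113 — 3 statements merged into one kernel-verified Lean document; each statement's English description precedes it below -/
import Mathlib

section
/- Fix positive integers m and k and a real α ≥ 1, and suppose there exists an ordinal algorithm for cardinality constrained scheduling on m machines with cardinality bound k of rate at most α. Then for every real ε > 0 there exists a robust algorithm for cardinality constrained scheduling on m machines with cardinality bound k with migration factor at most (1+ε)/ε that is ((1+ε)·α)-competitive. -/
open Finset

/-- The load of machine `i` under schedule `σ` for job sizes `p`. -/
noncomputable def machineLoad {n m : ℕ} (p : Fin n → ℝ) (σ : Fin n → Fin m) (i : Fin m) : ℝ :=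
  ∑ j ∈ Finset.univ.filter (fun j => σ j = i), p j

/-- The makespan of a schedule: the maximum machine load. -/
noncomputable def makespan {n m : ℕ} (p : Fin n → ℝ) (σ : Fin n → Fin m) : ℝ :=
  sSup (Set.range (machineLoad p σ))

/-- A schedule is feasible for cardinality bound `k` if every machine gets at most `k` jobs. -/
def Feasible {n m : ℕ} (k : ℕ) (σ : Fin n → Fin m) : Prop :=
  ∀ i : Fin m, (Finset.univ.filter (fun j => σ j = i)).card ≤ k

/-- The optimal (minimum) makespan over all feasible schedules on `m` machines with
cardinality bound `k`. -/
noncomputable def OPT (m k : ℕ) {n : ℕ} (p : Fin n → ℝ) : ℝ :=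
  sInf ((fun σ : Fin n → Fin m => makespan p σ) '' {σ | Feasible k σ})

/-- The schedule induced by a deterministic online algorithm `A` on input sequence `p`:
job `j` is assigned to the machine `A (p 1, …, p j)`. -/
def onlineSchedule {m : ℕ} (A : List ℝ → Fin m) {n : ℕ} (p : Fin n → ℝ) : Fin n → Fin m :=
  fun j => A ((List.ofFn p).take (j.1 + 1))

/-- An online algorithm is `α`-competitive if on every input sequence of at most `m*k`
nonnegative jobs the induced schedule is feasible and its makespan is at most `α * OPT`. -/
def Competitive (m k : ℕ) (A : List ℝ → Fin m) (α : ℝ) : Prop :=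
  ∀ n : ℕ, n ≤ m * k → ∀ p : Fin n → ℝ, (∀ j, 0 ≤ p j) →
    Feasible k (onlineSchedule A p) ∧
      makespan p (onlineSchedule A p) ≤ α * OPT m k p

/-- A (deterministic) algorithm processing jobs one by one: after the `t`-th job it outputs a
schedule of jobs `1, …, t` determined by the sizes of the first `t` jobs. -/
def RobustAlg (m : ℕ) := ∀ t : ℕ, (Fin t → ℝ) → Fin t → Fin m

/-- The first `t` jobs of an infinite input sequence. -/
def prefixSeq (p : ℕ → ℝ) (t : ℕ) : Fin t → ℝ := fun j => p j.1

/-- `R` is a robust algorithm for `m` machines and cardinality bound `k` with migration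
factor `β`: on every nonnegative input sequence, (i) each schedule `σ_t` with `t ≤ m*k` is
feasible, and (ii) the total size of the jobs `j < t` with `σ_t j ≠ σ_{t-1} j` is at most
`β` times the size of the `t`-th job. -/
def IsRobust (m k : ℕ) (β : ℝ) (R : RobustAlg m) : Prop :=
  ∀ p : ℕ → ℝ, (∀ j, 0 ≤ p j) →
    (∀ t : ℕ, t ≤ m * k → Feasible k (R t (prefixSeq p t))) ∧
    (∀ s : ℕ, s + 1 ≤ m * k →
      (∑ j ∈ Finset.univ.filter
          (fun j : Fin s =>
            R (s + 1) (prefixSeq p (s + 1)) j.castSucc ≠ R s (prefixSeq p s) j),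
        p j.1) ≤ β * p s)

/-- A robust algorithm is `α`-competitive if on every nonnegative input sequence and every
`t ≤ m*k`, the makespan of its schedule of the first `t` jobs is at most `α` times the
optimal makespan for these jobs. -/
def RobustCompetitive (m k : ℕ) (R : RobustAlg m) (α : ℝ) : Prop :=
  ∀ p : ℕ → ℝ, (∀ j, 0 ≤ p j) → ∀ t : ℕ, t ≤ m * k →
    makespan (prefixSeq p t) (R t (prefixSeq p t)) ≤ α * OPT m k (prefixSeq p t)

/-- An ordinal algorithm for `m` machines and cardinality bound `k` of rate at most `α`:
a fixed assignment of the positions `1, …, m*k` to machines with exactly `k` positions per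
machine such that for every non-increasing nonnegative size sequence the makespan of the
induced schedule is at most `α * OPT`. -/
def OrdinalRate (m k : ℕ) (σ : Fin (m * k) → Fin m) (α : ℝ) : Prop :=
  (∀ i : Fin m, (Finset.univ.filter (fun j => σ j = i)).card = k) ∧
  ∀ p : Fin (m * k) → ℝ, (∀ j, 0 ≤ p j) → Antitone p →
    makespan p σ ≤ α * OPT m k p

/-- The number of the first `t` keys that are larger than `v`. -/
noncomputable def countGt (q : ℕ → ℝ) (t : ℕ) (v : ℝ) : ℕ :=
  ((Finset.range t).filter (fun j => v < q j)).card

/-- The number of the first `t` keys that are at least `v`. -/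
noncomputable def countGe (q : ℕ → ℝ) (t : ℕ) (v : ℝ) : ℕ :=
  ((Finset.range t).filter (fun j => v ≤ q j)).card

open Classical in
/-- The position of job `j` among the first `t` jobs when these are kept sorted by non-increasing
key: a new job is put behind the last job with the same key, and the first job of each class of
smaller keys moves behind the last job of its class. -/
noncomputable def sortedPos (q : ℕ → ℝ) : ℕ → ℕ → ℕ
  | 0, _ => 0
  | t + 1, j =>
    if j = t then countGe q t (q t)
    else if q j < q t ∧ sortedPos q t j = countGt q t (q j) then countGe q t (q j)
    else sortedPos q t j

lemma countGt_succ (q : ℕ → ℝ) (t : ℕ) (v : ℝ) :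
    countGt q (t + 1) v = countGt q t v + if v < q t then 1 else 0 := by
  unfold countGt
  rw [Finset.range_add_one, Finset.filter_insert]
  split_ifs <;> simp

lemma countGe_succ (q : ℕ → ℝ) (t : ℕ) (v : ℝ) :
    countGe q (t + 1) v = countGe q t v + if v ≤ q t then 1 else 0 := by
  unfold countGe
  rw [Finset.range_add_one, Finset.filter_insert]
  split_ifs <;> simp

lemma countGt_le_countGe (q : ℕ → ℝ) (t : ℕ) (v : ℝ) : countGt q t v ≤ countGe q t v :=
  Finset.card_le_card (Finset.monotone_filter_right _ fun _ _ h => le_of_lt h)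

lemma countGe_le_countGt (q : ℕ → ℝ) (t : ℕ) {v w : ℝ} (h : v < w) :
    countGe q t w ≤ countGt q t v :=
  Finset.card_le_card (Finset.monotone_filter_right _ fun _ _ h' => lt_of_lt_of_le h h')

lemma countGe_le (q : ℕ → ℝ) (t : ℕ) (v : ℝ) : countGe q t v ≤ t := by
  simpa [countGe] using Finset.card_filter_le (Finset.range t) (fun j => v ≤ q j)

lemma countGt_congr {q q' : ℕ → ℝ} {t : ℕ} (h : ∀ j < t, q j = q' j) (v : ℝ) :
    countGt q t v = countGt q' t v := by
  unfold countGt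
  congr 1
  exact Finset.filter_congr fun j hj => by rw [h j (Finset.mem_range.1 hj)]

lemma countGe_congr {q q' : ℕ → ℝ} {t : ℕ} (h : ∀ j < t, q j = q' j) (v : ℝ) :
    countGe q t v = countGe q' t v := by
  unfold countGe
  congr 1
  exact Finset.filter_congr fun j hj => by rw [h j (Finset.mem_range.1 hj)]

lemma sortedPos_congr {q q' : ℕ → ℝ} {t : ℕ} (h : ∀ j < t, q j = q' j) :
    ∀ j < t, sortedPos q t j = sortedPos q' t j := by
  induction t with
  | zero => intro j hj; omega
  | succ t ih =>
    intro j hj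
    have h' : ∀ j < t, q j = q' j := fun i hi => h i (by omega)
    simp only [sortedPos]
    rw [h t (by omega), h j hj, countGe_congr h', countGe_congr h', countGt_congr h']
    by_cases hjt : j = t
    · simp [hjt]
    · rw [ih h' j (by omega)]

lemma sortedPos_bounds (q : ℕ → ℝ) (t : ℕ) :
    ∀ j < t, countGt q t (q j) ≤ sortedPos q t j ∧ sortedPos q t j < countGe q t (q j) := by
  induction t with
  | zero => intro j hj; omega
  | succ t ih =>
    intro j hj
    rw [countGt_succ, countGe_succ]
    simp only [sortedPos]
    by_cases hjt : j = t
    · subst hjt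
      have := countGt_le_countGe q j (q j)
      simp
      omega
    · obtain ⟨h1, h2⟩ := ih j (by omega)
      rw [if_neg hjt]
      by_cases hlt : q j < q t
      · simp only [hlt, hlt.le, if_true, true_and]
        split_ifs <;> omega
      · simp only [hlt, if_false, false_and]
        split_ifs <;> omega

lemma key_le_of_sortedPos_le {q : ℕ → ℝ} {t i j : ℕ} (hi : i < t) (hj : j < t)
    (h : sortedPos q t i ≤ sortedPos q t j) : q j ≤ q i := by
  by_contra! hlt
  have h1 := (sortedPos_bounds q t i hi).1
  have h2 := (sortedPos_bounds q t j hj).2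
  have h3 := countGe_le_countGt q t hlt
  omega

lemma sortedPos_lt (q : ℕ → ℝ) {t j : ℕ} (hj : j < t) : sortedPos q t j < t :=
  (sortedPos_bounds q t j hj).2.trans_le (countGe_le _ _ _)

lemma sortedPos_inj (q : ℕ → ℝ) (t : ℕ) :
    ∀ i < t, ∀ j < t, sortedPos q t i = sortedPos q t j → i = j := by
  induction t with
  | zero => intro j hj; omega
  | succ t ih =>
    intro i hi j hj hij
    have hq : q i = q j := le_antisymm (key_le_of_sortedPos_le hj hi hij.ge)
      (key_le_of_sortedPos_le hi hj hij.le)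
    simp only [sortedPos] at hij
    by_cases hit : i = t
    · by_cases hjt : j = t
      · omega
      · subst hit
        have := (sortedPos_bounds q i j (by omega)).2
        rw [if_pos rfl, if_neg hjt, if_neg (by simp [hq]), hq] at hij
        omega
    · have hbi := (sortedPos_bounds q t i (by omega)).2
      by_cases hjt : j = t
      · subst hjt
        rw [if_pos rfl, if_neg hit, if_neg (by simp [hq])] at hij
        rw [hq] at hbi
        omega
      · have hbj := (sortedPos_bounds q t j (by omega)).2
        apply ih i (by omega) j (by omega)
        rw [if_neg hit, if_neg hjt, hq] at hij
        rw [hq] at hbi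
        split_ifs at hij <;> omega

lemma exists_sortedPos_eq (q : ℕ → ℝ) {t x : ℕ} (hx : x < t) :
    ∃ j < t, sortedPos q t j = x := by
  have h := Finset.surjOn_of_injOn_of_card_le (s := Finset.range t) (t := Finset.range t)
    (sortedPos q t) (fun j hj => by simpa using sortedPos_lt q (by simpa using hj))
    (fun i hi j hj => sortedPos_inj q t i (by simpa using hi) j (by simpa using hj)) le_rfl
  obtain ⟨j, hj, hjx⟩ := h (by simpa using hx : x ∈ (Finset.range t : Set ℕ))
  exact ⟨j, by simpa using hj, hjx⟩

/-- Distinct values that are spaced by a factor `b` sum up to at most a geometric series. -/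
lemma sum_le_of_geometric_gaps {ι : Type*} {b : ℝ} (hb : 1 < b) (f : ι → ℝ)
    (hgap : ∀ i j, f i < f j → b * f i ≤ f j) (S : Finset ι) :
    ∀ v : ℝ, 0 ≤ v → Set.InjOn f S → (∀ i ∈ S, b * f i ≤ v) → ∑ i ∈ S, f i ≤ v / (b - 1) := by
  classical
  have hb' : 0 < b - 1 := by linarith
  induction S using Finset.induction_on_max_value f with
  | empty => intro v hv _ _; simpa using div_nonneg hv hb'.le
  | insert a s ha hmax ih =>
    intro v hv hinj hS
    rw [Finset.sum_insert ha]
    have hle : b * f a ≤ v := hS a (Finset.mem_insert_self _ _)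
    by_cases hfa : 0 ≤ f a
    · have h1 := ih (f a) hfa (hinj.mono (by simp)) fun i hi =>
        hgap i a (lt_of_le_of_ne (hmax i hi) fun h => ha (by
          rw [← hinj (by simp [hi]) (by simp) h]; exact hi))
      have h2 : f a + f a / (b - 1) = b * f a / (b - 1) := by field_simp; ring
      calc f a + ∑ i ∈ s, f i ≤ f a + f a / (b - 1) := by linarith
        _ = b * f a / (b - 1) := h2
        _ ≤ v / (b - 1) := by gcongr
    · have h1 : ∑ i ∈ s, f i ≤ 0 :=
        Finset.sum_nonpos fun i hi => (hmax i hi).trans (by linarith)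
      have := div_nonneg hv hb'.le
      linarith

/-- Rounding nonnegative reals up to powers of `b`. -/
lemma exists_geometric_rounding {b : ℝ} (hb : 1 < b) :
    ∃ r : ℝ → ℝ, (∀ x, 0 ≤ x → x ≤ r x ∧ r x ≤ b * x) ∧
      ∀ x y, r x < r y → b * r x ≤ r y := by
  have hb0 : 0 < b := by linarith
  have hex : ∀ x : ℝ, ∃ n : ℤ, 0 < x → x ∈ Set.Ioc (b ^ n) (b ^ (n + 1)) := fun x => by
    by_cases hx : 0 < x
    · obtain ⟨n, hn⟩ := exists_mem_Ioc_zpow hx hb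
      exact ⟨n, fun _ => hn⟩
    · exact ⟨0, fun h => absurd h hx⟩
  choose n hn using hex
  refine ⟨fun x => if 0 < x then b ^ (n x + 1) else 0, fun x hx => ?_, fun x y => ?_⟩
  · rcases hx.eq_or_lt with rfl | hx
    · simp
    · obtain ⟨h1, h2⟩ := hn x hx
      simp only [hx, if_true]
      refine ⟨h2, ?_⟩
      rw [zpow_add_one₀ hb0.ne', mul_comm]
      gcongr
  · by_cases hx : 0 < x <;> by_cases hy : 0 < y <;> simp only [hx, hy, if_true, if_false]
    · intro h
      have h1 := (zpow_lt_zpow_iff_right₀ hb).1 h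
      rw [mul_comm, ← zpow_add_one₀ hb0.ne']
      exact zpow_le_zpow_right₀ hb.le (by omega)
    · intro h
      exact absurd h (not_lt.2 (by positivity))
    · intro _
      simpa using (zpow_pos hb0 _).le
    · simp

lemma machineLoad_le_makespan {n m : ℕ} (p : Fin n → ℝ) (σ : Fin n → Fin m) (i : Fin m) :
    machineLoad p σ i ≤ makespan p σ :=
  le_csSup (Set.finite_range _).bddAbove ⟨i, rfl⟩

lemma makespan_le {n m : ℕ} (hm : 0 < m) {p : Fin n → ℝ} {σ : Fin n → Fin m} {c : ℝ}
    (h : ∀ i, machineLoad p σ i ≤ c) : makespan p σ ≤ c :=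
  csSup_le ⟨_, ⟨0, hm⟩, rfl⟩ (by rintro _ ⟨i, rfl⟩; exact h i)

lemma OPT_le_makespan {n m k : ℕ} (p : Fin n → ℝ) {σ : Fin n → Fin m} (h : Feasible k σ) :
    OPT m k p ≤ makespan p σ :=
  csInf_le (Set.toFinite _).bddBelow ⟨σ, h, rfl⟩

/-- The sizes `q` placed at the positions `e`, with zeros at unused positions. -/
def placeAt {t N : ℕ} (e : Fin t → Fin N) (q : Fin t → ℝ) (x : Fin N) : ℝ :=
  ∑ j ∈ Finset.univ.filter (fun j => e j = x), q j

lemma machineLoad_placeAt {t N m : ℕ} (e : Fin t → Fin N) (q : Fin t → ℝ) (τ : Fin N → Fin m)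
    (i : Fin m) : machineLoad (placeAt e q) τ i = machineLoad q (τ ∘ e) i := by
  simp only [machineLoad, placeAt, Finset.sum_filter]
  rw [← Finset.sum_filter, Finset.sum_comm]
  refine Finset.sum_congr rfl fun j _ => ?_
  simp [Finset.sum_ite_eq, Function.comp]

lemma Feasible.comp {t N m k : ℕ} {e : Fin t → Fin N} (he : Function.Injective e)
    {τ : Fin N → Fin m} (h : Feasible k τ) : Feasible k (τ ∘ e) := fun i =>
  (Finset.card_le_card_of_injOn e (fun j hj => by simpa using hj) he.injOn).trans (h i)

/-- A feasible schedule of jobs at some of the `m * k` positions extends to all positions. -/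
lemma Feasible.exists_extension {t m k : ℕ} {e : Fin t → Fin (m * k)}
    (he : Function.Injective e) {τ : Fin t → Fin m} (h : Feasible k τ) :
    ∃ τ' : Fin (m * k) → Fin m, Feasible k τ' ∧ τ' ∘ e = τ := by
  classical
  have hemb : ∀ i : Fin m, ∃ g : Fin t → Fin k, ∀ a b, τ a = i → τ b = i → g a = g b → a = b := by
    intro i
    have : Fintype.card {j // τ j = i} ≤ Fintype.card (Fin k) := by
      simpa [Fintype.card_subtype] using h i
    obtain ⟨g⟩ := Function.Embedding.nonempty_of_card_le this
    by_cases hne : ∃ j, τ j = i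
    · obtain ⟨j₀, hj₀⟩ := hne
      refine ⟨fun j => if hj : τ j = i then g ⟨j, hj⟩ else g ⟨j₀, hj₀⟩, fun a b ha hb hab => ?_⟩
      simpa [ha, hb] using hab
    · rcases Nat.eq_zero_or_pos t with rfl | ht
      · exact ⟨fun j => j.elim0, fun a => a.elim0⟩
      · refine ⟨fun _ => ⟨0, ?_⟩, fun a _ ha => absurd ⟨a, ha⟩ hne⟩
        have h0 := h (τ ⟨0, ht⟩)
        refine lt_of_lt_of_le (Finset.card_pos.2 ⟨⟨0, ht⟩, by simp⟩) h0
  choose g hg using hemb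
  let f : Fin t → Fin m × Fin k := fun j => (τ j, g (τ j) j)
  have hf : Function.Injective f := fun a b hab => by
    simp only [f, Prod.mk.injEq] at hab
    refine hg (τ a) a b rfl hab.1.symm ?_
    rw [hab.2, hab.1]
  rcases Nat.eq_zero_or_pos t with rfl | ht
  · refine ⟨fun x => (finProdFinEquiv.symm x).1, fun i => ?_, funext fun j => j.elim0⟩
    calc _ ≤ (Finset.univ : Finset (Fin k)).card :=
          Finset.card_le_card_of_injOn (fun x => (finProdFinEquiv.symm x).2) (by simp)
            fun a ha b hb hab => by
              simp only [Finset.coe_filter, Finset.mem_univ, true_and, Set.mem_ofPred_eq] at ha hb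
              exact finProdFinEquiv.symm.injective (Prod.ext (ha.trans hb.symm) hab)
      _ = k := by simp
  · have : Nonempty (Fin t) := ⟨⟨0, ht⟩⟩
    obtain ⟨E, hE⟩ := Finset.exists_equiv_extend_of_card_eq
      (α := Fin (m * k)) (t := (Finset.univ : Finset (Fin m × Fin k)))
      (s := Finset.univ.image e) (f := f ∘ Function.invFun e) (by simp) (by simp)
      (fun x hx y hy hxy => by
        simp only [Finset.coe_image, Finset.coe_univ, Set.image_univ, Set.mem_range] at hx hy
        obtain ⟨a, rfl⟩ := hx
        obtain ⟨b, rfl⟩ := hy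
        simp only [Function.comp, Function.leftInverse_invFun he _] at hxy
        rw [hf hxy])
    refine ⟨fun x => (E x : Fin m × Fin k).1, fun i => ?_, funext fun j => ?_⟩
    · calc _ ≤ (Finset.univ : Finset (Fin k)).card :=
            Finset.card_le_card_of_injOn (fun x => (E x : Fin m × Fin k).2) (by simp)
              fun a ha b hb hab => by
                simp only [Finset.coe_filter, Finset.mem_univ, true_and, Set.mem_ofPred_eq] at ha hb
                exact E.injective (Subtype.ext (Prod.ext (ha.trans hb.symm) hab))
        _ = k := by simp
    · simp only [Function.comp]
      rw [hE _ (by simp)]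
      simp [f, Function.leftInverse_invFun he _]

/-- Placing jobs at the positions of an ordinal algorithm in the order of keys that exceed the
sizes by a factor of at most `b` increases its rate by at most that factor. -/
lemma OrdinalRate.makespan_comp_le {t m k : ℕ} (hm : 0 < m) {α b : ℝ} (hα : 0 ≤ α) (hb : 0 < b)
    {σ : Fin (m * k) → Fin m} (hσ : OrdinalRate m k σ α) {e : Fin t → Fin (m * k)}
    (he : Function.Injective e) {p q : Fin t → ℝ} (hp : ∀ j, 0 ≤ p j) (hpq : ∀ j, p j ≤ q j)
    (hqp : ∀ j, q j ≤ b * p j) (hanti : Antitone (placeAt e q)) :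
    makespan p (σ ∘ e) ≤ b * α * OPT m k p := by
  have hfeas : Feasible k (σ ∘ e) := Feasible.comp he fun i => (hσ.1 i).le
  have hopt : OPT m k (placeAt e q) ≤ b * OPT m k p := by
    rw [← div_le_iff₀' hb]
    refine le_csInf ⟨_, _, hfeas, rfl⟩ ?_
    rintro _ ⟨τ, hτ, rfl⟩
    obtain ⟨τ', hτ', rfl⟩ := Feasible.exists_extension he hτ
    rw [div_le_iff₀' hb]
    refine (OPT_le_makespan _ hτ').trans (makespan_le hm fun i => ?_)
    rw [machineLoad_placeAt]
    refine le_trans ?_ (mul_le_mul_of_nonneg_left (machineLoad_le_makespan p (τ' ∘ e) i) hb.le)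
    simp only [machineLoad]
    rw [Finset.mul_sum]
    exact Finset.sum_le_sum fun j _ => hqp j
  calc makespan p (σ ∘ e) ≤ makespan (placeAt e q) σ := by
        refine makespan_le hm fun i => le_trans ?_ (machineLoad_le_makespan _ _ i)
        rw [machineLoad_placeAt]
        exact Finset.sum_le_sum fun j _ => hpq j
    _ ≤ α * OPT m k (placeAt e q) :=
        hσ.2 _ (fun x => Finset.sum_nonneg fun j _ => (hp j).trans (hpq j)) hanti
    _ ≤ α * (b * OPT m k p) := by gcongr
    _ = b * α * OPT m k p := by ring

lemma antitone_placeAt_sortedPos {t N : ℕ} {q : ℕ → ℝ} (hq : ∀ j, 0 ≤ q j)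
    {e : Fin t → Fin N} (he : ∀ j, (e j : ℕ) = sortedPos q t j) :
    Antitone (placeAt e fun j => q j) := by
  have hval : ∀ (x : Fin N) (j : Fin t), sortedPos q t j = x → placeAt e (fun j => q j) x = q j := by
    intro x j hj
    have : Finset.univ.filter (fun i => e i = x) = {j} := by
      ext i
      simp only [Finset.mem_filter, Finset.mem_univ, true_and, Finset.mem_singleton]
      constructor
      · rintro rfl
        exact Fin.ext (sortedPos_inj q t i i.2 j j.2 (by rw [← he, hj]))
      · rintro rfl
        exact Fin.ext (by rw [he, hj])
    simp [placeAt, this]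
  intro x y hxy
  have hxy' : (x : ℕ) ≤ y := hxy
  by_cases hy : (y : ℕ) < t
  · obtain ⟨i, hi, hix⟩ := exists_sortedPos_eq q (hxy'.trans_lt hy)
    obtain ⟨j, hj, hjy⟩ := exists_sortedPos_eq q hy
    rw [hval x ⟨i, hi⟩ hix, hval y ⟨j, hj⟩ hjy]
    exact key_le_of_sortedPos_le hi hj (by rwa [hix, hjy])
  · have : Finset.univ.filter (fun i => e i = y) = ∅ := by
      refine Finset.filter_eq_empty_iff.2 fun i _ h => hy ?_
      rw [← h, he]
      exact sortedPos_lt q i.2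
    rw [placeAt, this, Finset.sum_empty]
    exact Finset.sum_nonneg fun j _ => hq j

/-- The total key of the jobs that change position when job `s` arrives. -/
lemma sum_moved_le {q : ℕ → ℝ} {b : ℝ} (hb : 1 < b) (hq : ∀ j, 0 ≤ q j)
    (hgap : ∀ i j, q i < q j → b * q i ≤ q j) (s : ℕ) (S : Finset (Fin s))
    (hS : ∀ j ∈ S, sortedPos q (s + 1) j ≠ sortedPos q s j) :
    ∑ j ∈ S, q j ≤ q s / (b - 1) := by
  have hS' : ∀ j ∈ S, q j < q s ∧ sortedPos q s j = countGt q s (q j) := fun j hj => by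
    by_contra hn
    refine hS j hj ?_
    rw [sortedPos, if_neg j.2.ne, if_neg hn]
  refine sum_le_of_geometric_gaps hb (fun j : Fin s => q j) (fun i j => hgap i j) S _ (hq s) ?_
    fun j hj => hgap j s (hS' j hj).1
  intro i hi j hj hij
  refine Fin.ext (sortedPos_inj q s i i.2 j j.2 ?_)
  rw [(hS' i hi).2, (hS' j hj).2, show q i = q j from hij]


/-- If there is an ordinal algorithm on `m` machines with cardinality bound `k` of rate at
most `α`, then for every `ε > 0` there is a robust algorithm with migration factor at most
`(1+ε)/ε` that is `((1+ε)·α)`-competitive. -/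
theorem ordinal_to_robust (m k : ℕ) (hm : 0 < m) (hk : 0 < k) (α : ℝ) (hα : 1 ≤ α)
    (hord : ∃ σ : Fin (m * k) → Fin m, OrdinalRate m k σ α) :
    ∀ ε : ℝ, 0 < ε →
      ∃ R : RobustAlg m,
        IsRobust m k ((1 + ε) / ε) R ∧ RobustCompetitive m k R ((1 + ε) * α) := by
  obtain ⟨σ, hσ⟩ := hord
  intro ε hε
  have hb : 1 < 1 + ε := by linarith
  obtain ⟨r, hr, hgap⟩ := exists_geometric_rounding hb
  let σ' : ℕ → Fin m := fun x => if hx : x < m * k then σ ⟨x, hx⟩ else ⟨0, hm⟩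
  let R : RobustAlg m := fun t x j =>
    σ' (sortedPos (fun i => if h : i < t then r (x ⟨i, h⟩) else 0) t j)
  have hR : ∀ (p : ℕ → ℝ) (t : ℕ) (j : Fin t),
      R t (prefixSeq p t) j = σ' (sortedPos (fun i => r (p i)) t j) := fun p t j => by
    refine congrArg σ' (sortedPos_congr (fun i hi => ?_) j j.2)
    simp [hi, prefixSeq]
  let e : ∀ (p : ℕ → ℝ) (t : ℕ), t ≤ m * k → Fin t → Fin (m * k) := fun p t ht j =>
    ⟨sortedPos (fun i => r (p i)) t j, (sortedPos_lt _ j.2).trans_le ht⟩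
  have he : ∀ p t ht, Function.Injective (e p t ht) := fun p t ht i j hij =>
    Fin.ext (sortedPos_inj _ t i i.2 j j.2 (congrArg Fin.val hij))
  have hRe : ∀ p t ht, R t (prefixSeq p t) = σ ∘ e p t ht := fun p t ht => by
    funext j
    rw [hR]
    exact dif_pos (e p t ht j).2
  refine ⟨R, fun p hp => ⟨fun t ht => ?_, fun s _ => ?_⟩, fun p hp t ht => ?_⟩
  · rw [hRe p t ht]
    exact Feasible.comp (he p t ht) fun i => (hσ.1 i).le
  · have hmoved := sum_moved_le hb (q := fun i => r (p i))
      (fun j => (hp j).trans (hr _ (hp j)).1) (fun i j => hgap _ _) s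
      (Finset.univ.filter (fun j : Fin s =>
        R (s + 1) (prefixSeq p (s + 1)) j.castSucc ≠ R s (prefixSeq p s) j))
      (fun j hj heq => by
        rw [Finset.mem_filter, hR, hR] at hj
        exact hj.2 (congrArg σ' heq))
    refine (Finset.sum_le_sum fun (j : Fin s) _ => (hr _ (hp j)).1).trans (hmoved.trans ?_)
    rw [add_sub_cancel_left, div_mul_eq_mul_div]
    gcongr
    exact (hr _ (hp s)).2
  · rw [hRe p t ht]
    exact hσ.makespan_comp_le hm (by linarith) (by linarith) (he p t ht)
      (q := fun j => r (p j)) (fun j => hp j) (fun j => (hr _ (hp j)).1)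
      (fun j => (hr _ (hp j)).2)
      (antitone_placeAt_sortedPos (q := fun i => r (p i))
        (fun j => (hp j).trans (hr _ (hp j)).1) fun _ => rfl)
end

section
/- Let X = (−3 + √837)/2. Fix an integer m ≥ 3, a real β ≥ 0, and a real α ≥ 1. Suppose that for every positive integer k there is a robust algorithm for cardinality constrained scheduling on m machines with cardinality bound k having migration factor β, and that each of these algorithms is α-competitive. Then α ≥ (X + 6)/18. -/
open Finset

/-- The sequence made of blocks of lengths `r`, `2`, `3`, `(r - 1) * K` and a final infinite
block, with constant values `a`, `b`, `c`, `d`, `e`. -/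
noncomputable def blockSeq (r K : ℕ) (a b c d e : ℝ) (j : ℕ) : ℝ :=
  if j < r then a else if j < r + 2 then b else if j < r + 5 then c
  else if j - (r + 5) < (r - 1) * K then d else e

/-- The machine assignment that groups the first three blocks of `blockSeq` separately. -/
def groupedAssignment (r j : ℕ) : ℕ :=
  if j < r then j else if j < r + 2 then r else r + 1

/-- The machine assignment that mixes the first three blocks of `blockSeq` and distributes the
remaining jobs in groups of `K` over all machines but the first. -/
def mixedAssignment (r K j : ℕ) : ℕ :=
  if j < r + 2 then j else if j = r + 2 then 0 else if j < r + 5 then j - 3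
  else 1 + (j - (r + 5)) / K

lemma OPT_le_of_feasible {n m k : ℕ} [NeZero m] {p : Fin n → ℝ} {σ : Fin n → Fin m} {c : ℝ}
    (hσ : Feasible k σ) (hc : ∀ i, machineLoad p σ i ≤ c) : OPT m k p ≤ c := by
  have h : OPT m k p ≤ makespan p σ :=
    csInf_le (Set.toFinite _).bddBelow ⟨σ, hσ, rfl⟩
  refine h.trans (csSup_le (Set.range_nonempty _) ?_)
  rintro _ ⟨i, rfl⟩
  exact hc i

lemma machineLoad_prefixSeq {n m : ℕ} (p : ℕ → ℝ) (f : ℕ → ℕ) (hf : ∀ j < n, f j < m)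
    (i : Fin m) :
    machineLoad (prefixSeq p n) (fun j => ⟨f j, hf j j.2⟩) i =
      ∑ j ∈ range n, if f j = i then p j else 0 := by
  rw [machineLoad, Finset.sum_filter,
    ← Fin.sum_univ_eq_sum_range (fun j => if f j = i then p j else 0)]
  simp [Fin.ext_iff, prefixSeq]

lemma feasible_of_sum_le {n m k : ℕ} (f : ℕ → ℕ) (hf : ∀ j < n, f j < m)
    (h : ∀ i < m, (∑ j ∈ range n, if f j = i then (1 : ℝ) else 0) ≤ k) :
    Feasible (n := n) (m := m) k (fun j => ⟨f j, hf j j.2⟩) := by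
  intro i
  have h1 := h i i.2
  rw [← machineLoad_prefixSeq (fun _ => 1) f hf i] at h1
  simpa [machineLoad, prefixSeq] using h1

lemma sum_range_mul_div (n K : ℕ) (h : ℕ → ℝ) :
    ∑ i ∈ range (n * K), h (i / K) = ∑ q ∈ range n, K * h q := by
  rcases Nat.eq_zero_or_pos K with rfl | hK
  · simp
  induction n with
  | zero => simp
  | succ n ih =>
    rw [Nat.succ_mul, Finset.sum_range_add, ih, Finset.sum_range_succ]
    congr 1
    have : ∀ i ∈ range K, h ((n * K + i) / K) = h n := by
      intro i hi
      rw [Nat.mul_comm, Nat.mul_add_div hK, Nat.div_eq_of_lt (Finset.mem_range.1 hi), add_zero]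
    rw [Finset.sum_congr rfl this]
    simp

lemma groupedAssignment_lt (r j : ℕ) : groupedAssignment r j < r + 2 := by
  unfold groupedAssignment
  split_ifs <;> omega

lemma mixedAssignment_lt {r K j : ℕ} (hK : 0 < K) (hj : j < r + 5 + (r + 1) * K) :
    mixedAssignment r K j < r + 2 := by
  unfold mixedAssignment
  split_ifs
  · omega
  · omega
  · omega
  · have : (j - (r + 5)) / K < r + 1 := (Nat.div_lt_iff_lt_mul hK).2 (by omega)
    omega

lemma sum_groupedAssignment (r K : ℕ) (a b c d e : ℝ) {i : ℕ} (hi : i < r + 2) :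
    (∑ j ∈ range (r + 5), if groupedAssignment r j = i then blockSeq r K a b c d e j else 0) =
      if i < r then a else if i = r then 2 * b else 3 * c := by
  have h1 : (∑ j ∈ range r,
      if groupedAssignment r j = i then blockSeq r K a b c d e j else 0) =
      if i < r then a else 0 := by
    rw [Finset.sum_congr rfl (g := fun j => if j = i then a else 0)]
    · simp [Finset.sum_ite_eq']
    · intro j hj
      have hj := Finset.mem_range.1 hj
      simp [groupedAssignment, blockSeq, hj]
  rw [Finset.sum_range_add, h1]
  rcases (by omega : i < r ∨ i = r ∨ i = r + 1) with h | rfl | rfl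
  · have : r ≠ i := by omega
    have : r + 1 ≠ i := by omega
    simp [Finset.sum_range_succ, groupedAssignment, blockSeq, *]
  · simp [Finset.sum_range_succ, groupedAssignment, blockSeq]
    ring
  · simp [Finset.sum_range_succ, groupedAssignment, blockSeq]
    ring

lemma sum_mixedAssignment {r K : ℕ} (hr : 0 < r) (hK : 0 < K) (a b c d e : ℝ) {i : ℕ}
    (hi : i < r + 2) :
    (∑ j ∈ range (r + 5 + (r + 1) * K),
        if mixedAssignment r K j = i then blockSeq r K a b c d e j else 0) =
      if i = 0 then a + c else if i < r then a + K * d else b + c + K * e := by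
  have h1 : (∑ j ∈ range r,
      if mixedAssignment r K j = i then blockSeq r K a b c d e j else 0) =
      if i < r then a else 0 := by
    rw [Finset.sum_congr rfl (g := fun j => if j = i then a else 0)]
    · simp [Finset.sum_ite_eq']
    · intro j hj
      have hj := Finset.mem_range.1 hj
      have : j < r + 2 := by omega
      simp [mixedAssignment, blockSeq, hj, this]
  have h2 : (∑ j ∈ range ((r + 1) * K),
      if mixedAssignment r K (r + 5 + j) = i then blockSeq r K a b c d e (r + 5 + j) else 0) =
      if i = 0 then 0 else if i < r then K * d else K * e := by
    have : ∀ j, (if mixedAssignment r K (r + 5 + j) = i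
        then blockSeq r K a b c d e (r + 5 + j) else 0) =
        (fun q => if 1 + q = i then (if q < r - 1 then d else e) else 0) (j / K) := by
      intro j
      have e1 : ¬ r + 5 + j < r := by omega
      have e2 : ¬ r + 5 + j < r + 2 := by omega
      have e3 : ¬ r + 5 + j = r + 2 := by omega
      have e4 : ¬ r + 5 + j < r + 5 := by omega
      have e5 : r + 5 + j - (r + 5) = j := by omega
      simp only [mixedAssignment, blockSeq, e1, e2, e3, e4, e5, if_false,
        Nat.div_lt_iff_lt_mul hK]
    rw [Finset.sum_congr rfl (fun j _ => this j),
      sum_range_mul_div _ _ fun q => if 1 + q = i then (if q < r - 1 then d else e) else 0]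
    rcases i with _ | i
    · simp
    · rw [Finset.sum_eq_single i]
      · have : i < r - 1 ↔ i + 1 < r := by omega
        rw [if_pos (add_comm 1 i), if_neg (Nat.succ_ne_zero i)]
        simp only [this]
        split_ifs <;> rfl
      · intro q _ hq
        have : ¬ 1 + q = i + 1 := by omega
        simp [this]
      · intro h
        exact absurd (Finset.mem_range.2 (by omega)) h
  rw [Finset.sum_range_add, h2, Finset.sum_range_add, h1]
  have h0 : r ≠ 0 := by omega
  rcases (by omega : i = 0 ∨ (i ≠ 0 ∧ i < r) ∨ i = r ∨ i = r + 1) with rfl | ⟨h, h'⟩ | rfl | rfl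
  · simp [Finset.sum_range_succ, mixedAssignment, blockSeq, hr, h0]
  · have e1 : r ≠ i := by omega
    have e2 : r + 1 ≠ i := by omega
    have e3 : 0 ≠ i := by omega
    simp [Finset.sum_range_succ, mixedAssignment, blockSeq, *]
  · have e3 : 0 ≠ i := by omega
    simp [Finset.sum_range_succ, mixedAssignment, blockSeq, *]
  · simp [Finset.sum_range_succ, mixedAssignment, blockSeq]

lemma blockSeq_const (r K : ℕ) (a : ℝ) (j : ℕ) : blockSeq r K a a a a a j = a := by
  simp [blockSeq]

lemma OPT_blockSeq_prefix_le {r K : ℕ} (hK : 0 < K) {a b c d e C : ℝ}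
    (ha : a ≤ C) (hb : 2 * b ≤ C) (hc : 3 * c ≤ C) :
    OPT (r + 2) (K + 2) (prefixSeq (blockSeq r K a b c d e) (r + 5)) ≤ C := by
  refine OPT_le_of_feasible
    (feasible_of_sum_le (groupedAssignment r) (fun j _ => groupedAssignment_lt r j) ?_) ?_
  · intro i hi
    have h := sum_groupedAssignment r K 1 1 1 1 1 hi
    simp only [blockSeq_const] at h
    rw [h]
    have : (1 : ℝ) ≤ K := by exact_mod_cast hK
    push_cast
    split_ifs <;> linarith
  · intro i
    rw [machineLoad_prefixSeq _ _ (fun j _ => groupedAssignment_lt r j),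
      sum_groupedAssignment r K _ _ _ _ _ i.2]
    split_ifs <;> assumption

lemma OPT_blockSeq_le {r K : ℕ} (hr : 0 < r) (hK : 0 < K) {a b c d e C : ℝ}
    (h1 : a + c ≤ C) (h2 : a + K * d ≤ C) (h3 : b + c + K * e ≤ C) :
    OPT (r + 2) (K + 2) (prefixSeq (blockSeq r K a b c d e) (r + 5 + (r + 1) * K)) ≤ C := by
  refine OPT_le_of_feasible
    (feasible_of_sum_le (mixedAssignment r K) (fun j hj => mixedAssignment_lt hK hj) ?_) ?_
  · intro i hi
    have h := sum_mixedAssignment hr hK 1 1 1 1 1 hi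
    simp only [blockSeq_const] at h
    rw [h]
    have : (1 : ℝ) ≤ K := by exact_mod_cast hK
    push_cast
    split_ifs <;> linarith
  · intro i
    rw [machineLoad_prefixSeq _ _ (fun j hj => mixedAssignment_lt hK hj),
      sum_mixedAssignment hr hK _ _ _ _ _ i.2]
    split_ifs <;> assumption

/-- Jobs that are too large to be migrated by any later job keep their machine. -/
lemma IsRobust.eq_of_large {m k : ℕ} {β : ℝ} {R : RobustAlg m} (hR : IsRobust m k β R)
    {p : ℕ → ℝ} (hp : ∀ j, 0 ≤ p j) {s j : ℕ} (hj : j < s)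
    (hlarge : ∀ u, s ≤ u → β * p u < p j) {t : ℕ} (hst : s ≤ t) (ht : t ≤ m * k) :
    R t (prefixSeq p t) ⟨j, hj.trans_le hst⟩ = R s (prefixSeq p s) ⟨j, hj⟩ := by
  induction t, hst using Nat.le_induction with
  | base => rfl
  | succ t hst ih =>
    rw [← ih (by omega)]
    by_contra hne
    have h := (hR p hp).2 t ht
    refine absurd (hlarge t hst) (not_lt.2 (le_trans ?_ h))
    refine Finset.single_le_sum (f := fun j : Fin t => p j.1) (a := ⟨j, hj.trans_le hst⟩)
      (fun i _ => hp i) ?_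
    exact Finset.mem_filter.2 ⟨Finset.mem_univ _, hne⟩

lemma add_le_makespan {n m : ℕ} {p : Fin n → ℝ} (hp : ∀ j, 0 ≤ p j) (σ : Fin n → Fin m)
    {i j : Fin n} (hij : i ≠ j) (h : σ i = σ j) : p i + p j ≤ makespan p σ := by
  refine le_trans ?_ (machineLoad_le_makespan p σ (σ j))
  rw [machineLoad, ← Finset.sum_pair hij]
  refine Finset.sum_le_sum_of_subset_of_nonneg ?_ (fun l _ _ => hp l)
  intro l hl
  rcases Finset.mem_insert.1 hl with rfl | hl
  · simp [h]
  · simp [Finset.mem_singleton.1 hl]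

/-- If all jobs have size at least `e` and the jobs of a set `J` run on machines from `B`, then
the cardinality bound for the other machines forces load onto the machines in `B`. -/
lemma le_card_mul_makespan {n m k : ℕ} {p : Fin n → ℝ} {σ : Fin n → Fin m}
    (hσ : Feasible k σ) {e : ℝ} (he : 0 ≤ e) (hp : ∀ j, e ≤ p j) (B : Finset (Fin m))
    (J : Finset (Fin n)) (hJ : ∀ j ∈ J, σ j ∈ B) :
    ((n : ℝ) - (Bᶜ.card : ℝ) * k) * e + ∑ j ∈ J, (p j - e) ≤ (B.card : ℝ) * makespan p σ := by
  have hload : ∑ i ∈ B, machineLoad p σ i ≤ B.card * makespan p σ := by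
    rw [← nsmul_eq_mul]
    exact Finset.sum_le_card_nsmul _ _ _ fun i _ => machineLoad_le_makespan p σ i
  have hfib : ∑ i ∈ B, machineLoad p σ i = ∑ j with σ j ∈ B, p j := by
    rw [← Finset.sum_fiberwise_of_maps_to (s := Finset.univ.filter fun j => σ j ∈ B) (t := B)
      (g := σ) (fun j hj => (Finset.mem_filter.1 hj).2)]
    refine Finset.sum_congr rfl fun i hi => ?_
    rw [machineLoad, Finset.filter_filter]
    refine Finset.sum_congr (Finset.filter_congr fun j _ => ?_) fun _ _ => rfl
    exact ⟨fun h => ⟨h ▸ hi, h⟩, fun h => h.2⟩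
  have hcompl : (Finset.univ.filter fun j => ¬ σ j ∈ B).card ≤ Bᶜ.card * k := by
    rw [Nat.mul_comm]
    refine Finset.card_le_mul_card_image_of_maps_to (f := σ)
      (fun j hj => Finset.mem_compl.2 (Finset.mem_filter.1 hj).2) k fun i _ => ?_
    refine le_trans (Finset.card_le_card ?_) (hσ i)
    exact Finset.filter_subset_filter _ (Finset.filter_subset _ _)
  have hcard : (n : ℝ) - (Bᶜ.card : ℝ) * k ≤ (Finset.univ.filter fun j => σ j ∈ B).card := by
    have h := Finset.card_filter_add_card_filter_not (s := (Finset.univ : Finset (Fin n)))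
      (fun j => σ j ∈ B)
    rw [Finset.card_univ, Fintype.card_fin] at h
    have h' : n ≤ (Finset.univ.filter fun j => σ j ∈ B).card + Bᶜ.card * k := by omega
    have : (n : ℝ) ≤ (Finset.univ.filter fun j => σ j ∈ B).card + Bᶜ.card * k := by
      exact_mod_cast h'
    linarith
  have hsub : ∑ j ∈ J, (p j - e) ≤ ∑ j with σ j ∈ B, (p j - e) :=
    Finset.sum_le_sum_of_subset_of_nonneg
      (fun j hj => Finset.mem_filter.2 ⟨Finset.mem_univ j, hJ j hj⟩)
      fun j _ _ => sub_nonneg.2 (hp j)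
  have hsplit : ∑ j with σ j ∈ B, (p j - e) =
      ∑ j with σ j ∈ B, p j - (Finset.univ.filter fun j => σ j ∈ B).card * e := by
    rw [Finset.sum_sub_distrib, Finset.sum_const, nsmul_eq_mul]
  have := mul_le_mul_of_nonneg_right hcard he
  linarith

/-- A robust algorithm that is better than `(x + 6) / 18`-competitive keeps the jobs of size `x`
alone, and then suffers from the cardinality bound once many tiny jobs have arrived. -/
lemma RobustCompetitive.two_mul_le {r K : ℕ} (hr : 0 < r) (hK : 0 < K) {x α β : ℝ}
    (hx : 9 ≤ x) (hx' : x ≤ 15) (hβ : 0 ≤ β) (hα : 0 ≤ α) (hβK : β < K)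
    (hlt : 18 * α < x + 6) {R : RobustAlg (r + 2)} (hR : IsRobust (r + 2) (K + 2) β R)
    (hc : RobustCompetitive (r + 2) (K + 2) R α) :
    ((K : ℝ) - r) * ((x - 9) / K) + 36 ≤ 2 * (α * (x + 6)) := by
  have hK' : (0 : ℝ) < K := by exact_mod_cast hK
  set e : ℝ := (x - 9) / K with he_def
  set p := blockSeq r K x 9 6 (6 / K) e with hp_def
  have he : 0 ≤ e := div_nonneg (by linarith) hK'.le
  have hed : e ≤ 6 / K := div_le_div_of_nonneg_right (by linarith) hK'.le
  have hd6 : 6 / (K : ℝ) ≤ 6 := div_le_self (by norm_num) (by exact_mod_cast hK)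
  have hpe : ∀ j, e ≤ p j := by
    intro j
    rw [hp_def, blockSeq]
    split_ifs <;> linarith
  have hp : ∀ j, 0 ≤ p j := fun j => he.trans (hpe j)
  have hp6 : ∀ j < r + 5, 6 ≤ p j := by
    intro j hj
    rw [hp_def, blockSeq]
    split_ifs <;> linarith
  have hpx : ∀ j < r, p j = x := by
    intro j hj
    simp [hp_def, blockSeq, hj]
  have hsmall : ∀ u, r + 5 ≤ u → β * p u < 6 := by
    intro u hu
    have h1 : p u ≤ 6 / K := by
      have e1 : ¬ u < r := by omega
      have e2 : ¬ u < r + 2 := by omega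
      have e3 : ¬ u < r + 5 := by omega
      simp only [hp_def, blockSeq, e1, e2, e3, if_false]
      split_ifs <;> linarith
    calc β * p u ≤ β * (6 / K) := mul_le_mul_of_nonneg_left h1 hβ
      _ < K * (6 / K) := mul_lt_mul_of_pos_right hβK (by positivity)
      _ = 6 := by field_simp
  have hn : r + 5 + (r + 1) * K ≤ (r + 2) * (K + 2) := by nlinarith
  have hn0 : r + 5 ≤ (r + 2) * (K + 2) := by nlinarith
  set σ₀ := R (r + 5) (prefixSeq p (r + 5))
  set σ := R (r + 5 + (r + 1) * K) (prefixSeq p (r + 5 + (r + 1) * K))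
  have hspan₀ : makespan (prefixSeq p (r + 5)) σ₀ < x + 6 := by
    have h1 := hc p hp _ hn0
    have h2 : OPT (r + 2) (K + 2) (prefixSeq p (r + 5)) ≤ 18 :=
      OPT_blockSeq_prefix_le hK (by linarith) (by norm_num) (by norm_num)
    nlinarith [mul_le_mul_of_nonneg_left h2 hα]
  have hspan : makespan (prefixSeq p (r + 5 + (r + 1) * K)) σ ≤ α * (x + 6) := by
    refine (hc p hp _ hn).trans (mul_le_mul_of_nonneg_left ?_ hα)
    refine OPT_blockSeq_le hr hK le_rfl ?_ ?_
    · rw [mul_div_cancel₀ _ hK'.ne']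
    · rw [he_def, mul_div_cancel₀ _ hK'.ne']
      linarith
  have halone : ∀ (i : Fin r) (j : Fin (r + 5)), Fin.castAdd 5 i ≠ j →
      σ₀ (Fin.castAdd 5 i) ≠ σ₀ j := by
    intro i j hij h
    have h1 := add_le_makespan (p := prefixSeq p (r + 5)) (fun j => hp j) σ₀ hij h
    have h2 : prefixSeq p (r + 5) (Fin.castAdd 5 i) = x := hpx i i.2
    have h3 : 6 ≤ prefixSeq p (r + 5) j := hp6 j j.2
    linarith
  set A : Finset (Fin (r + 2)) := Finset.univ.image fun i : Fin r => σ₀ (Fin.castAdd 5 i)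
    with hA
  have hAcard : A.card = r := by
    rw [hA, Finset.card_image_of_injective, Finset.card_univ, Fintype.card_fin]
    intro i j hij
    by_contra hne
    exact halone i _ (fun h => hne (Fin.castAdd_injective r 5 h)) hij
  have hBcard : Aᶜ.card = 2 := by
    rw [Finset.card_compl, hAcard, Fintype.card_fin]
    omega
  have hle : r + 5 ≤ r + 5 + (r + 1) * K := Nat.le_add_right _ _
  let mid : Fin 5 ↪ Fin (r + 5 + (r + 1) * K) :=
    (Fin.natAddEmb r).trans (Fin.castLEEmb hle)
  have hmid : ∀ j ∈ Finset.univ.map mid, σ j ∈ Aᶜ := by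
    intro j hj
    obtain ⟨l, -, rfl⟩ := Finset.mem_map.1 hj
    have hl : r + l.1 < r + 5 := by omega
    have h1 : σ (mid l) = σ₀ (Fin.natAdd r l) :=
      hR.eq_of_large hp hl (fun u hu => (hsmall u hu).trans_le (hp6 _ hl)) hle hn
    rw [h1, Finset.mem_compl, hA, Finset.mem_image]
    rintro ⟨i, -, hi⟩
    refine halone i _ (fun h => ?_) hi
    have := congrArg Fin.val h
    simp at this
    omega
  have hmain := le_card_mul_makespan (p := prefixSeq p (r + 5 + (r + 1) * K))
    ((hR p hp).1 _ hn) he (fun j => hpe j) Aᶜ (Finset.univ.map mid) hmid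
  have hsum : ∑ j ∈ Finset.univ.map mid,
      (prefixSeq p (r + 5 + (r + 1) * K) j - e) = 36 - 5 * e := by
    rw [Finset.sum_map]
    simp [Fin.sum_univ_succ, mid, prefixSeq, hp_def, blockSeq]
    ring
  rw [hsum, compl_compl, hAcard, hBcard] at hmain
  push_cast at hmain
  have : ((r : ℝ) + 5 + (r + 1) * K - r * (K + 2)) * e + (36 - 5 * e) =
      (K - r) * e + 36 := by ring
  linarith

/-- Let `X = (-3 + √837)/2`.  Fix `m ≥ 3`, `β ≥ 0`, `α ≥ 1`.  If for every positive
cardinality bound `k` there is a robust algorithm on `m` machines with migration factor `β`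
that is `α`-competitive, then `α ≥ (X + 6)/18 ≈ 1.0536`. -/
theorem robust_lower_bound (m : ℕ) (hm : 3 ≤ m) (β α : ℝ) (hβ : 0 ≤ β) (hα : 1 ≤ α)
    (R : ℕ → RobustAlg m)
    (hrob : ∀ k : ℕ, 0 < k → IsRobust m k β (R k) ∧ RobustCompetitive m k (R k) α) :
    ((-3 + Real.sqrt 837) / 2 + 6) / 18 ≤ α := by
  obtain ⟨r, rfl⟩ : ∃ r, m = r + 2 := ⟨m - 2, by omega⟩
  have hsq : Real.sqrt 837 ^ 2 = 837 := Real.sq_sqrt (by norm_num)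
  set x : ℝ := (-3 + Real.sqrt 837) / 2 with hx_def
  have hx : 9 < x := by
    have : 21 < Real.sqrt 837 := Real.lt_sqrt_of_sq_lt (by norm_num)
    linarith
  have hx' : x ≤ 15 := by
    have : Real.sqrt 837 ≤ 33 := Real.sqrt_le_iff.2 (by norm_num)
    linarith
  have hxeq : (x + 6) ^ 2 = 18 * (18 + (x - 9) / 2) := by
    rw [hx_def]
    nlinarith
  by_contra! hlt
  have hlt' : 18 * α < x + 6 := by linarith
  have hgap : 0 < 36 + (x - 9) - 2 * (α * (x + 6)) := by nlinarith
  obtain ⟨K, hKlarge⟩ :=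
    exists_nat_gt (max β (r * (x - 9) / (36 + (x - 9) - 2 * (α * (x + 6)))))
  obtain ⟨hβK, hK⟩ := max_lt_iff.1 hKlarge
  have hK0 : (0 : ℝ) < K := hβ.trans_lt hβK
  obtain ⟨hR, hc⟩ := hrob (K + 2) (by omega)
  have h := hc.two_mul_le (by omega) (by exact_mod_cast hK0) hx.le hx' hβ (by linarith) hβK
    hlt' hR
  rw [div_lt_iff₀ hgap] at hK
  have h1 : ((K : ℝ) - r) * ((x - 9) / K) * K = (K - r) * (x - 9) := by
    field_simp
  nlinarith [mul_le_mul_of_nonneg_right h hK0.le]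
end

section
/- There exists a constant C > 0 such that for every real ε with 0 < ε < 1 and every integer k > 1/ε², there is a robust algorithm for cardinality constrained scheduling on m = 2 machines with cardinality bound k whose migration factor is at most C/ε⁵ and which is (1+ε)-competitive. -/
open Finset

section Reduction

variable {k : ℕ}

/-- The first `t` sizes, followed by zeros. -/
def truncSeq (p : ℕ → ℝ) (t : ℕ) : Fin (2 * k) → ℝ := fun j => if j.1 < t then p j.1 else 0

lemma truncSeq_succ (p : ℕ → ℝ) {s : ℕ} (hs : s < 2 * k) :
    (truncSeq p (s + 1) : Fin (2 * k) → ℝ) = Function.update (truncSeq p s) ⟨s, hs⟩ (p s) := by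
  ext j
  rcases eq_or_ne j ⟨s, hs⟩ with h | h
  · subst h; simp [truncSeq]
  · rw [Function.update_of_ne h]
    have h' : j.1 ≠ s := fun e => h (Fin.ext e)
    have : j.1 < s + 1 ↔ j.1 < s := by omega
    simp only [truncSeq, this]

lemma truncSeq_congr {p q : ℕ → ℝ} {t : ℕ} (h : ∀ j < t, p j = q j) :
    (truncSeq p t : Fin (2 * k) → ℝ) = truncSeq q t := by
  ext j
  simp only [truncSeq]
  split_ifs with hj
  · exact h _ hj
  · rfl

open Classical in
/-- One step of the algorithm: choose a successor state with small migration. -/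
noncomputable def nextState (Inv : (Fin (2 * k) → ℝ) → (Fin (2 * k) → Fin 2) → Prop) (β : ℝ)
    (v : Fin (2 * k) → ℝ) (τ : Fin (2 * k) → Fin 2) (t : Fin (2 * k)) (x : ℝ) :
    Fin (2 * k) → Fin 2 :=
  if h : ∃ τ', Inv (Function.update v t x) τ' ∧
    ∑ j ∈ univ.filter (fun j => τ' j ≠ τ j), v j ≤ β * x then h.choose else τ

/-- The schedules of all (present and future) jobs produced by iterating `nextState`. -/
noncomputable def runState (Inv : (Fin (2 * k) → ℝ) → (Fin (2 * k) → Fin 2) → Prop) (β : ℝ)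
    (τ₀ : Fin (2 * k) → Fin 2) (p : ℕ → ℝ) : ℕ → Fin (2 * k) → Fin 2
  | 0 => τ₀
  | s + 1 => if h : s < 2 * k then
      nextState Inv β (truncSeq p s) (runState Inv β τ₀ p s) ⟨s, h⟩ (p s)
    else runState Inv β τ₀ p s

lemma runState_congr {Inv : (Fin (2 * k) → ℝ) → (Fin (2 * k) → Fin 2) → Prop} {β : ℝ}
    {τ₀ : Fin (2 * k) → Fin 2} {p q : ℕ → ℝ} (t : ℕ) (h : ∀ j < t, p j = q j) :
    runState Inv β τ₀ p t = runState Inv β τ₀ q t := by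
  induction t with
  | zero => rfl
  | succ s ih =>
    have h1 := ih fun j hj => h j (by omega)
    simp only [runState, h1, h s (by omega), truncSeq_congr (k := k) fun j (hj : j < s) =>
      h j (by omega)]

lemma sum_eq_sum_castLE {n t : ℕ} (ht : t ≤ n) (f : Fin n → ℝ) (hf : ∀ j, t ≤ j.1 → f j = 0) :
    ∑ j, f j = ∑ j : Fin t, f (Fin.castLE ht j) := by
  obtain ⟨d, rfl⟩ := Nat.exists_eq_add_of_le ht
  rw [Fin.sum_univ_add]
  rw [Finset.sum_eq_zero (s := (univ : Finset (Fin d))) fun i _ => hf _ (by simp), add_zero]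
  rfl

lemma exists_balanced_extension {t : ℕ} (ht : t ≤ 2 * k) {ρ : Fin t → Fin 2} (hρ : Feasible k ρ) :
    ∃ ρ' : Fin (2 * k) → Fin 2, (∀ j, ρ' (Fin.castLE ht j) = ρ j) ∧
      ∀ i, (univ.filter (fun j => ρ' j = i)).card = k := by
  set ι : Fin t ↪ Fin (2 * k) := Fin.castLEEmb ht
  set A₀ := (univ.filter (fun j => ρ j = 0)).map ι with hA₀
  set A₁ := (univ.filter (fun j => ρ j = 1)).map ι with hA₁
  have hc₀ : A₀.card ≤ k := by rw [hA₀, card_map]; exact hρ 0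
  have hc₁ : A₁.card ≤ k := by rw [hA₁, card_map]; exact hρ 1
  have hsub : A₀ ⊆ A₁ᶜ := by
    intro j hj
    simp only [hA₀, hA₁, mem_map, mem_filter, mem_univ, true_and, mem_compl] at hj ⊢
    rintro ⟨b, hb, rfl⟩
    obtain ⟨a, ha, hab⟩ := hj
    rw [ι.injective hab, hb] at ha
    exact absurd ha (by decide)
  have hcard : (A₁ᶜ).card = 2 * k - A₁.card := by rw [card_compl, Fintype.card_fin]
  obtain ⟨A, hA0, hA1, hAk⟩ := exists_subsuperset_card_eq hsub hc₀ (by omega)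
  refine ⟨fun j => if j ∈ A then 0 else 1, fun j => ?_, fun i => ?_⟩
  · by_cases hj : ρ j = 0
    · rw [hj]
      exact if_pos (hA0 (mem_map.2 ⟨j, by simpa using hj, rfl⟩))
    · have hj1 : ρ j = 1 := by omega
      rw [hj1]
      exact if_neg fun hmem => mem_compl.1 (hA1 hmem) (mem_map.2 ⟨j, by simpa using hj1, rfl⟩)
  · fin_cases i
    · simpa using hAk
    · have : (univ.filter (fun j : Fin (2 * k) => (if j ∈ A then (0 : Fin 2) else 1) = 1)) = Aᶜ := by
        ext j; by_cases h : j ∈ A <;> simp [h]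
      simp only [Fin.mk_one, this]
      rw [card_compl, Fintype.card_fin, hAk]
      omega

lemma machineLoad_eq_sum_ite {n m : ℕ} (p : Fin n → ℝ) (σ : Fin n → Fin m) (i : Fin m) :
    machineLoad p σ i = ∑ j, if σ j = i then p j else 0 := by
  rw [machineLoad, sum_filter]

lemma machineLoad_truncSeq {t : ℕ} (ht : t ≤ 2 * k) (p : ℕ → ℝ) (ρ : Fin t → Fin 2)
    (ρ' : Fin (2 * k) → Fin 2) (h : ∀ j, ρ' (Fin.castLE ht j) = ρ j) (i : Fin 2) :
    machineLoad (truncSeq p t) ρ' i = machineLoad (prefixSeq p t) ρ i := by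
  rw [machineLoad_eq_sum_ite, machineLoad_eq_sum_ite, sum_eq_sum_castLE ht]
  · refine sum_congr rfl fun j _ => ?_
    rw [h]
    simp [truncSeq, prefixSeq]
  · intro j hj
    simp [truncSeq, not_lt.2 hj]

/-- A robust algorithm may be described by an invariant of balanced schedules of `2 * k` jobs, the
jobs that have not arrived yet having size zero. -/
lemma exists_robustAlg {α β : ℝ} (hα : 0 < α)
    (Inv : (Fin (2 * k) → ℝ) → (Fin (2 * k) → Fin 2) → Prop)
    (hinit : ∃ τ, Inv 0 τ)
    (hbal : ∀ v τ, Inv v τ → ∀ i, (univ.filter (fun j => τ j = i)).card = k)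
    (happrox : ∀ v τ, Inv v τ → 0 ≤ v → ∀ ρ : Fin (2 * k) → Fin 2,
      (∀ i, (univ.filter (fun j => ρ j = i)).card = k) →
      ∀ i, ∃ i', machineLoad v τ i ≤ α * machineLoad v ρ i')
    (hstep : ∀ v τ t x, 0 ≤ v → v t = 0 → 0 ≤ x → Inv v τ →
      ∃ τ', Inv (Function.update v t x) τ' ∧
        ∑ j ∈ univ.filter (fun j => τ' j ≠ τ j), v j ≤ β * x) :
    ∃ R : RobustAlg 2, IsRobust 2 k β R ∧ RobustCompetitive 2 k R α := by
  obtain ⟨τ₀, hτ₀⟩ := hinit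
  have hnonneg : ∀ (p : ℕ → ℝ), (∀ j, 0 ≤ p j) → ∀ t, (0 : Fin (2 * k) → ℝ) ≤ truncSeq p t := by
    intro p hp t j
    simp only [truncSeq]
    split_ifs
    · exact hp _
    · exact le_rfl
  have hchoose : ∀ (p : ℕ → ℝ), (∀ j, 0 ≤ p j) → ∀ s (hs : s < 2 * k),
      Inv (truncSeq p s) (runState Inv β τ₀ p s) →
      Inv (truncSeq p (s + 1)) (runState Inv β τ₀ p (s + 1)) ∧
      ∑ j ∈ univ.filter (fun j => runState Inv β τ₀ p (s + 1) j ≠ runState Inv β τ₀ p s j),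
        truncSeq p s j ≤ β * p s := by
    intro p hp s hs hinv
    have hex := hstep (truncSeq p s) (runState Inv β τ₀ p s) ⟨s, hs⟩ (p s) (hnonneg p hp s)
      (by simp [truncSeq]) (hp s) hinv
    rw [truncSeq_succ p hs]
    have hrun : runState Inv β τ₀ p (s + 1) = hex.choose := by
      simp only [runState, hs, dif_pos, nextState]
      rw [dif_pos hex]
    rw [hrun]
    exact hex.choose_spec
  have hrun : ∀ (p : ℕ → ℝ), (∀ j, 0 ≤ p j) → ∀ t ≤ 2 * k,
      Inv (truncSeq p t) (runState Inv β τ₀ p t) := by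
    intro p hp t
    induction t with
    | zero =>
      intro _
      have : (truncSeq p 0 : Fin (2 * k) → ℝ) = 0 := by ext j; simp [truncSeq]
      rw [this]
      exact hτ₀
    | succ s ih => exact fun hs => (hchoose p hp s (by omega) (ih (by omega))).1
  set ext : ∀ t : ℕ, (Fin t → ℝ) → ℕ → ℝ := fun t q j => if h : j < t then q ⟨j, h⟩ else 0 with hext
  set R : RobustAlg 2 := fun t q j =>
    if h : j.1 < 2 * k then runState Inv β τ₀ (ext t q) t ⟨j.1, h⟩ else 0 with hR
  have hRrun : ∀ (p : ℕ → ℝ) (t : ℕ) (ht : t ≤ 2 * k) (j : Fin t),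
      runState Inv β τ₀ p t (Fin.castLE ht j) = R t (prefixSeq p t) j := by
    intro p t ht j
    have h1 : runState Inv β τ₀ (ext t (prefixSeq p t)) t = runState Inv β τ₀ p t :=
      runState_congr t fun i hi => by simp [hext, hi, prefixSeq]
    simp only [hR]
    rw [dif_pos (by omega), h1]
    rfl
  have hfeas : ∀ (p : ℕ → ℝ), (∀ j, 0 ≤ p j) → ∀ t ≤ 2 * k, Feasible k (R t (prefixSeq p t)) := by
    intro p hp t ht i
    rw [← hbal _ _ (hrun p hp t ht) i, ← card_map (Fin.castLEEmb ht)]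
    refine card_le_card fun j hj => ?_
    obtain ⟨a, ha, rfl⟩ := mem_map.1 hj
    simp only [mem_filter, mem_univ, true_and] at ha ⊢
    rw [← ha, ← hRrun p t ht a]
    rfl
  refine ⟨R, fun p hp => ⟨hfeas p hp, fun s hs => ?_⟩, fun p hp t ht => ?_⟩
  · have h1 := (hchoose p hp s (by omega) (hrun p hp s (by omega))).2
    refine le_trans (le_of_eq ?_) h1
    rw [sum_filter, sum_filter, sum_eq_sum_castLE (show s ≤ 2 * k by omega)]
    · refine sum_congr rfl fun j _ => ?_
      rw [hRrun p s (by omega) j, ← hRrun p (s + 1) hs j.castSucc]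
      simp only [truncSeq, Fin.val_castLE, j.2, if_true]
      rfl
    · intro j hj
      simp [truncSeq, not_lt.2 hj]
  · have hle : ∀ σ : Fin t → Fin 2, Feasible k σ →
        makespan (prefixSeq p t) (R t (prefixSeq p t)) ≤ α * makespan (prefixSeq p t) σ := by
      intro σ hσ
      refine csSup_le (Set.range_nonempty _) ?_
      rintro _ ⟨i, rfl⟩
      obtain ⟨ρ', hρ, hρk⟩ := exists_balanced_extension ht hσ
      obtain ⟨i', hi'⟩ := happrox _ _ (hrun p hp t ht) (hnonneg p hp t) ρ' hρk i
      rw [machineLoad_truncSeq ht p _ _ (hRrun p t ht), machineLoad_truncSeq ht p _ _ hρ] at hi'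
      refine hi'.trans (mul_le_mul_of_nonneg_left ?_ hα.le)
      exact le_csSup (Set.finite_range _).bddAbove ⟨i', rfl⟩
    rw [← div_le_iff₀' hα]
    refine le_csInf ⟨_, _, hfeas p hp t ht, rfl⟩ ?_
    rintro _ ⟨σ, hσ, rfl⟩
    rw [div_le_iff₀' hα]
    exact hle σ hσ

end Reduction

/-- Distinct values that are separated by a factor `q > 1` form a sum dominated by a geometric
series. -/
lemma sum_le_of_separated {ι : Type*} [DecidableEq ι] {q : ℝ} (hq : 1 < q) {f : ι → ℝ}
    (A : Finset ι) : ∀ X : ℝ, 0 ≤ X → (∀ i ∈ A, 0 ≤ f i ∧ f i ≤ X) → Set.InjOn f A →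
      (∀ i ∈ A, ∀ j ∈ A, f i < f j → q * f i ≤ f j) → (q - 1) * ∑ i ∈ A, f i ≤ q * X := by
  induction A using Finset.induction_on_max_value f with
  | empty => intro X hX _ _ _; simp; positivity
  | insert a s ha hmax ih =>
    intro X hX hb hinj hsep
    have ha0 := hb a (mem_insert_self a s)
    have hlt : ∀ i ∈ s, q * f i ≤ f a := fun i hi => by
      refine hsep i (mem_insert_of_mem hi) a (mem_insert_self a s) (lt_of_le_of_ne (hmax i hi) ?_)
      intro h
      exact ha (hinj (by simp [hi]) (by simp) h ▸ hi)
    have h1 := ih (f a / q) (div_nonneg ha0.1 (by linarith))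
      (fun i hi => ⟨(hb i (mem_insert_of_mem hi)).1, by
        rw [le_div_iff₀ (by linarith)]; linarith [hlt i hi]⟩)
      (hinj.mono (by simp)) (fun i hi j hj => hsep i (mem_insert_of_mem hi) j (mem_insert_of_mem hj))
    rw [mul_div_cancel₀ _ (by linarith : q ≠ 0)] at h1
    rw [sum_insert ha]
    nlinarith [ha0.2]

/-- The machine of the job in position `i` of a decreasing ordering: `true` stands for the machine
`M` with the heavier big jobs. The `b` largest jobs avoid `M`, their mirror images go to `M`, the
other mirrored pairs alternate, and the positions from `2 * K` on all go to the machine `T`. -/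
def side (K : ℕ) (T : Bool) (b i : ℕ) : Bool :=
  if i < K then decide (b ≤ i) && decide (i % 2 = 1)
  else if i < 2 * K then !(decide (b ≤ 2 * K - 1 - i) && decide ((2 * K - 1 - i) % 2 = 1))
  else T

/-- The gain from exchanging position `i` with its mirror image, which counts as zero if it is
negligible. -/
noncomputable def gain (K : ℕ) (δ : ℝ) (s : ℕ → ℝ) (i : ℕ) : ℝ :=
  s i - if s (2 * K - 1 - i) < δ * s i then 0 else s (2 * K - 1 - i)

open Classical in
/-- The number of mirrored pairs needed to compensate a difference `D`. -/
noncomputable def fillCount (K : ℕ) (δ D : ℝ) (s : ℕ → ℝ) : ℕ :=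
  Nat.find (⟨K, Or.inl le_rfl⟩ :
    ∃ b, K ≤ b ∨ D ≤ ∑ i ∈ range b, gain K δ s i ∨ gain K δ s b = 0)

lemma fillCount_spec (K : ℕ) (δ D : ℝ) (s : ℕ → ℝ) :
    K ≤ fillCount K δ D s ∨ D ≤ ∑ i ∈ range (fillCount K δ D s), gain K δ s i ∨
      gain K δ s (fillCount K δ D s) = 0 := by
  classical
  exact Nat.find_spec (⟨K, Or.inl le_rfl⟩ :
    ∃ b, K ≤ b ∨ D ≤ ∑ i ∈ range b, gain K δ s i ∨ gain K δ s b = 0)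

lemma fillCount_le (K : ℕ) (δ D : ℝ) (s : ℕ → ℝ) : fillCount K δ D s ≤ K := by
  classical
  exact Nat.find_min' _ (Or.inl le_rfl)

lemma lt_fillCount {K : ℕ} {δ D : ℝ} {s : ℕ → ℝ} {c : ℕ} (h : c < fillCount K δ D s) :
    c < K ∧ ∑ i ∈ range c, gain K δ s i < D ∧ gain K δ s c ≠ 0 := by
  classical
  have := Nat.find_min (⟨K, Or.inl le_rfl⟩ :
    ∃ b, K ≤ b ∨ D ≤ ∑ i ∈ range b, gain K δ s i ∨ gain K δ s b = 0) h
  push Not at this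
  exact this

section Gain

variable {K : ℕ} {δ : ℝ} {s : ℕ → ℝ}

lemma gain_nonneg_le (hs : Antitone s) (h0 : ∀ i, 0 ≤ s i) {i : ℕ} (hi : i < K) :
    0 ≤ gain K δ s i ∧ gain K δ s i ≤ s i := by
  have h1 : s (2 * K - 1 - i) ≤ s i := hs (by omega)
  have h2 := h0 (2 * K - 1 - i)
  have h3 := h0 i
  unfold gain
  split_ifs <;> constructor <;> linarith

lemma sub_mirror_le_gain (h0 : ∀ i, 0 ≤ s i) (i : ℕ) :
    s i - s (2 * K - 1 - i) ≤ gain K δ s i := by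
  have h2 := h0 (2 * K - 1 - i)
  unfold gain
  split_ifs <;> linarith

lemma gain_le_sub_mirror (hδ : 0 ≤ δ) (h0 : ∀ i, 0 ≤ s i) (i : ℕ) :
    gain K δ s i ≤ s i - s (2 * K - 1 - i) + δ * s i := by
  have h2 := mul_nonneg hδ (h0 i)
  unfold gain
  split_ifs <;> linarith

lemma mirror_eq_of_gain_eq_zero (hs : Antitone s) (h0 : ∀ i, 0 ≤ s i) {i : ℕ} (hi : i < K)
    (h : gain K δ s i = 0) : s (2 * K - 1 - i) = s i := by
  have h1 : s (2 * K - 1 - i) ≤ s i := hs (by omega)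
  have h2 := h0 (2 * K - 1 - i)
  unfold gain at h
  split_ifs at h <;> linarith

lemma gain_eq_zero_of_mirror_eq (hδ : δ ≤ 1) (h0 : ∀ i, 0 ≤ s i) {i : ℕ}
    (h : s (2 * K - 1 - i) = s i) : gain K δ s i = 0 := by
  have h2 : δ * s i ≤ s i := by nlinarith [h0 i]
  unfold gain
  rw [h, if_neg (not_lt.2 h2), sub_self]

lemma le_gain_of_ne_zero {q : ℝ} (hs : Antitone s) (h0 : ∀ i, 0 ≤ s i)
    (hsep : ∀ i j, s i < s j → q * s i ≤ s j) {i : ℕ} (hi : i < K) (h : gain K δ s i ≠ 0) :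
    (q - 1) * s i ≤ q * gain K δ s i := by
  have h1 : s (2 * K - 1 - i) ≤ s i := hs (by omega)
  have h3 := h0 i
  unfold gain at h ⊢
  split_ifs at h ⊢
  · nlinarith
  · have := hsep _ _ (lt_of_le_of_ne h1 (fun h' => h (by rw [h', sub_self])))
    nlinarith

end Gain

/-- The fill count is stable: if two decreasing sequences differ in few positions, then the jobs
between the two fill counts have small total size. -/
lemma sum_Ico_fillCount_le {K : ℕ} {δ D q X : ℝ} {s s' : ℕ → ℝ} (hq : 1 < q) (hδ : 0 < δ)
    (hδ1 : δ ≤ 1) (hX : 0 ≤ X) (hs : Antitone s) (hs' : Antitone s') (h0 : ∀ i, 0 ≤ s i)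
    (h0' : ∀ i, 0 ≤ s' i) (hsep : ∀ i j, s i < s j → q * s i ≤ s j)
    (hsep' : ∀ i j, s' i < s' j → q * s' i ≤ s' j)
    (hinj : Set.InjOn s {i | s i ≠ s' i}) (hinj' : Set.InjOn s' {i | s i ≠ s' i})
    (hle : ∀ i, s i ≠ s' i → s i ≤ X ∧ s' i ≤ X)
    (hb : fillCount K δ D s < fillCount K δ D s') :
    ∑ i ∈ Ico (fillCount K δ D s) (fillCount K δ D s'), s' i
      ≤ X / δ + 2 * X * (q / (q - 1)) ^ 2 := by
  set b := fillCount K δ D s with hbdef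
  set b' := fillCount K δ D s' with hbdef'
  have hbK' : b' ≤ K := fillCount_le _ _ _ _
  have hX1 : X ≤ X / δ := by rw [le_div_iff₀ hδ]; nlinarith
  have hq1 : 0 < q - 1 := by linarith
  have hsb' : s' b ≤ X / δ := by
    by_contra! hcon
    have key : ∀ i ≤ b, gain K δ s i = gain K δ s' i := by
      intro i hi
      have h1 : X / δ < s' i := hcon.trans_le (hs' hi)
      have h2 : s i = s' i := by
        by_contra h
        linarith [(hle i h).2]
      have h3 : X < δ * s' i := by rwa [div_lt_iff₀' hδ] at h1
      by_cases h4 : s (2 * K - 1 - i) = s' (2 * K - 1 - i)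
      · simp only [gain, h2, h4]
      · have h5 := hle _ h4
        simp only [gain, h2]
        rw [if_pos (h5.1.trans_lt h3), if_pos (h5.2.trans_lt h3)]
    obtain ⟨-, h2, h3⟩ := lt_fillCount hb
    rcases fillCount_spec K δ D s with h | h | h
    · omega
    · rw [← hbdef] at h
      rw [sum_congr rfl (fun i hi => key i (mem_range.1 hi).le)] at h
      linarith
    · exact h3 (by rw [← key _ le_rfl]; exact h)
  have hpos : 0 ≤ 2 * X * (q / (q - 1)) ^ 2 := by positivity
  rcases fillCount_spec K δ D s with h | h | h
  · omega
  · rw [← hbdef] at h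
    obtain ⟨c, hc⟩ : ∃ c, b' = c + 1 := ⟨b' - 1, by omega⟩
    have hbc : b ≤ c := by omega
    rw [hc, sum_Ico_succ_top hbc]
    have hlast : s' c ≤ X / δ := (hs' hbc).trans hsb'
    have h1 : ∀ i ∈ Ico b c, (q - 1) * s' i ≤ q * gain K δ s' i := fun i hi => by
      rw [mem_Ico] at hi
      obtain ⟨e1, -, e2⟩ := lt_fillCount (K := K) (δ := δ) (D := D) (s := s') (c := i)
        (by rw [← hbdef']; omega)
      exact le_gain_of_ne_zero hs' h0' hsep' e1 e2
    have h2 := sum_le_sum h1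
    rw [← mul_sum, ← mul_sum] at h2
    have h3 : ∑ i ∈ range c, gain K δ s' i < D :=
      (lt_fillCount (K := K) (δ := δ) (D := D) (s := s') (c := c) (by rw [← hbdef']; omega)).2.1
    have h4 := sum_range_add_sum_Ico (fun i => gain K δ s' i) hbc
    -- total change of the gains
    have h5 : ∑ i ∈ range b, gain K δ s i - ∑ i ∈ range b, gain K δ s' i
        ≤ ∑ i ∈ (range (2 * K)).filter (fun i => s i ≠ s' i), (s i + s' i) := by
      have h6 : ∀ i ∈ range b, gain K δ s i - gain K δ s' i
          ≤ (if s i ≠ s' i then s i + s' i else 0) +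
            (if s (2 * K - 1 - i) ≠ s' (2 * K - 1 - i) then
              s (2 * K - 1 - i) + s' (2 * K - 1 - i) else 0) := by
        intro i hi
        have hi' : i < K := by have := mem_range.1 hi; omega
        have g1 := gain_nonneg_le (δ := δ) hs h0 hi'
        have g2 := gain_nonneg_le (δ := δ) hs' h0' hi'
        have e1 := h0 (2 * K - 1 - i)
        have e2 := h0' (2 * K - 1 - i)
        have e3 := h0' i
        by_cases c1 : s i = s' i
        · by_cases c2 : s (2 * K - 1 - i) = s' (2 * K - 1 - i)
          · simp [gain, c1, c2]
          · rw [if_neg (not_not.2 c1), if_pos c2]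
            unfold gain
            rw [c1]
            split_ifs <;> linarith
        · rw [if_pos c1]
          split_ifs <;> linarith
      rw [← sum_sub_distrib]
      refine (sum_le_sum h6).trans ?_
      rw [sum_add_distrib, sum_filter]
      set F : ℕ → ℝ := fun i => if s i ≠ s' i then s i + s' i else 0 with hF
      have hF0 : ∀ i, 0 ≤ F i := fun i => by
        simp only [hF]; split_ifs
        · exact add_nonneg (h0 i) (h0' i)
        · exact le_rfl
      change ∑ i ∈ range b, F i + ∑ i ∈ range b, F (2 * K - 1 - i) ≤ ∑ i ∈ range (2 * K), F i
      have h7 : ∑ i ∈ range (2 * K), F i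
          = ∑ i ∈ range K, F i + ∑ i ∈ range K, F (2 * K - 1 - i) := by
        rw [two_mul, sum_range_add, ← sum_range_reflect (fun i => F (K + i))]
        congr 1
        refine sum_congr rfl fun i hi => ?_
        have := mem_range.1 hi
        congr 1
        omega
      rw [h7]
      have hsub : range b ⊆ range K := range_subset_range.2 (by omega)
      exact add_le_add (sum_le_sum_of_subset_of_nonneg hsub fun i _ _ => hF0 _)
        (sum_le_sum_of_subset_of_nonneg hsub fun i _ _ => hF0 _)
    have h6 : (q - 1) * ∑ i ∈ (range (2 * K)).filter (fun i => s i ≠ s' i), (s i + s' i)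
        ≤ 2 * (q * X) := by
      rw [sum_add_distrib, mul_add]
      have a1 := sum_le_of_separated hq (f := s) ((range (2 * K)).filter (fun i => s i ≠ s' i)) X hX
        (fun i hi => ⟨h0 i, (hle i (mem_filter.1 hi).2).1⟩)
        (hinj.mono (fun i hi => by simpa using (mem_filter.1 hi).2)) (fun i _ j _ => hsep i j)
      have a2 := sum_le_of_separated hq (f := s') ((range (2 * K)).filter (fun i => s i ≠ s' i)) X hX
        (fun i hi => ⟨h0' i, (hle i (mem_filter.1 hi).2).2⟩)
        (hinj'.mono (fun i hi => by simpa using (mem_filter.1 hi).2)) (fun i _ j _ => hsep' i j)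
      linarith
    have h8 : ∑ i ∈ Ico b c, s' i ≤ 2 * X * (q / (q - 1)) ^ 2 := by
      have h9 : ∑ i ∈ Ico b c, gain K δ s' i ≤ 2 * (q * X) / (q - 1) := by
        rw [le_div_iff₀ hq1]
        nlinarith
      rw [div_pow, mul_div_assoc', le_div_iff₀ (by positivity)]
      rw [le_div_iff₀ hq1] at h9
      nlinarith
    linarith
  · rw [← hbdef] at h
    have hm := mirror_eq_of_gain_eq_zero hs h0 (by omega) h
    have hconst : ∀ i, b ≤ i → i ≤ 2 * K - 1 - b → s i = s b := fun i h1 h2 =>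
      le_antisymm (hs h1) (hm ▸ hs h2)
    have hone : b' = b + 1 := by
      by_contra hne
      have hex : ∀ i, i = b ∨ i = b + 1 → ∃ j, (j = i ∨ j = 2 * K - 1 - i) ∧ s j ≠ s' j := by
        intro i hi
        obtain ⟨e1, -, e2⟩ := lt_fillCount (K := K) (δ := δ) (D := D) (s := s') (c := i)
          (by rw [← hbdef']; omega)
        by_contra! hcon
        refine e2 (gain_eq_zero_of_mirror_eq hδ1 h0' ?_)
        rw [← hcon i (Or.inl rfl), ← hcon (2 * K - 1 - i) (Or.inr rfl),
          hconst i (by omega) (by omega), hconst (2 * K - 1 - i) (by omega) (by omega)]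
      obtain ⟨j1, c1, d1⟩ := hex b (Or.inl rfl)
      obtain ⟨j2, c2, d2⟩ := hex (b + 1) (Or.inr rfl)
      have := hinj d1 d2 ((hconst j1 (by omega) (by omega)).trans
        (hconst j2 (by omega) (by omega)).symm)
      omega
    rw [hone, sum_Ico_succ_top le_rfl]
    simp
    linarith
section Side

variable {K : ℕ} {T : Bool}

lemma side_mirror (b : ℕ) {i : ℕ} (hi : i < K) :
    side K T b (2 * K - 1 - i) = !side K T b i := by
  have h1 : ¬ 2 * K - 1 - i < K := by omega
  have h2 : 2 * K - 1 - i < 2 * K := by omega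
  have h3 : 2 * K - 1 - (2 * K - 1 - i) = i := by omega
  simp only [side, h1, h2, hi, h3, if_true, if_false]

lemma side_of_lt (b : ℕ) {i : ℕ} (hi : i < K) :
    side K T b i = (decide (b ≤ i) && decide (i % 2 = 1)) := by
  simp only [side, hi, if_true]

lemma side_of_le (b : ℕ) {i : ℕ} (hi : 2 * K ≤ i) : side K T b i = T := by
  have h1 : ¬ i < K := by omega
  have h2 : ¬ i < 2 * K := by omega
  simp only [side, h1, h2, if_false]

lemma sum_range_eq_sum_mirror (f : ℕ → ℝ) {N : ℕ} (hN : 2 * K ≤ N) :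
    ∑ i ∈ range N, f i
      = ∑ i ∈ range K, f i + ∑ i ∈ range K, f (2 * K - 1 - i) + ∑ i ∈ Ico (2 * K) N, f i := by
  rw [← sum_range_add_sum_Ico f hN, two_mul, sum_range_add,
    ← sum_range_reflect (fun i => f (K + i))]
  congr 2
  refine sum_congr rfl fun i hi => ?_
  have := mem_range.1 hi
  congr 1
  omega

lemma sum_side_ne_le {s : ℕ → ℝ} (hs : Antitone s) (h0 : ∀ i, 0 ≤ s i) {b b' : ℕ} (hb : b ≤ b')
    (hb' : b' ≤ K) {N : ℕ} (hN : 2 * K ≤ N) :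
    ∑ i ∈ (range N).filter (fun i => side K T b i ≠ side K T b' i), s i
      ≤ 2 * ∑ i ∈ Ico b b', s i := by
  have h1 : ∀ i ∈ range K, (if side K T b i ≠ side K T b' i then s i else 0)
      ≤ if b ≤ i ∧ i < b' then s i else 0 := by
    intro i hi
    rw [side_of_lt _ (mem_range.1 hi), side_of_lt _ (mem_range.1 hi)]
    by_cases h : b ≤ i ∧ i < b'
    · rw [if_pos h]; split_ifs
      · exact le_rfl
      · exact h0 i
    · rw [if_neg h, if_neg]
      rw [not_not]
      have : b ≤ i ↔ b' ≤ i := by omega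
      simp only [this]
  have h2 : ∑ i ∈ range K, (if b ≤ i ∧ i < b' then s i else 0) = ∑ i ∈ Ico b b', s i := by
    rw [← sum_filter]
    refine sum_congr ?_ fun _ _ => rfl
    ext i
    simp only [mem_filter, mem_range, mem_Ico]
    omega
  have h3 : ∀ i ∈ range K, (if side K T b (2 * K - 1 - i) ≠ side K T b' (2 * K - 1 - i) then
      s (2 * K - 1 - i) else 0) ≤ if side K T b i ≠ side K T b' i then s i else 0 := by
    intro i hi
    have hi' := mem_range.1 hi
    rw [side_mirror _ hi', side_mirror _ hi']
    have h4 : s (2 * K - 1 - i) ≤ s i := hs (by omega)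
    by_cases h : side K T b i = side K T b' i
    · simp [h]
    · rw [if_pos h, if_pos (by simpa using h)]
      exact h4
  have h4 : ∀ i ∈ Ico (2 * K) N, (if side K T b i ≠ side K T b' i then s i else 0) = 0 := by
    intro i hi
    have hi' := (mem_Ico.1 hi).1
    rw [side_of_le _ hi', side_of_le _ hi']
    simp
  rw [sum_filter, sum_range_eq_sum_mirror _ hN, sum_eq_zero h4]
  have a1 := sum_le_sum h1
  have a3 := sum_le_sum h3
  linarith

lemma card_side (b : ℕ) {N : ℕ} (hN : 2 * K ≤ N) :
    ((range N).filter (fun i => side K T b i = true)).card = K + if T then N - 2 * K else 0 := by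
  have h : (((range N).filter (fun i => side K T b i = true)).card : ℝ)
      = ((K + if T then N - 2 * K else 0 : ℕ) : ℝ) := by
    rw [card_filter]
    push_cast
    rw [sum_range_eq_sum_mirror _ hN, ← sum_add_distrib]
    have h1 : ∀ i ∈ range K, ((if side K T b i = true then (1 : ℝ) else 0) +
        if side K T b (2 * K - 1 - i) = true then (1 : ℝ) else 0) = 1 := by
      intro i hi
      rw [side_mirror _ (mem_range.1 hi)]
      cases side K T b i <;> simp
    have h2 : ∀ i ∈ Ico (2 * K) N, (if side K T b i = true then (1 : ℝ) else 0)
        = if T then 1 else 0 := by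
      intro i hi
      rw [side_of_le _ (mem_Ico.1 hi).1]
    rw [sum_congr rfl h1, sum_congr rfl h2]
    cases T <;> simp
  exact_mod_cast h

end Side

lemma alternating_sum_bounds {a : ℕ → ℝ} (ha : Antitone a) (h0 : ∀ i, 0 ≤ a i) (n : ℕ) :
    ∀ b : ℕ,
      (b % 2 = 1 → 0 ≤ ∑ i ∈ Ico b (b + n), (if i % 2 = 1 then a i else -a i) ∧
        ∑ i ∈ Ico b (b + n), (if i % 2 = 1 then a i else -a i) ≤ a b) ∧
      (b % 2 = 0 → -a b ≤ ∑ i ∈ Ico b (b + n), (if i % 2 = 1 then a i else -a i) ∧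
        ∑ i ∈ Ico b (b + n), (if i % 2 = 1 then a i else -a i) ≤ 0) := by
  induction n with
  | zero => intro b; simp [h0 b]
  | succ n ih =>
    intro b
    have h1 : ∑ i ∈ Ico b (b + (n + 1)), (if i % 2 = 1 then a i else -a i)
        = (if b % 2 = 1 then a b else -a b) +
          ∑ i ∈ Ico (b + 1) (b + 1 + n), (if i % 2 = 1 then a i else -a i) := by
      rw [sum_eq_sum_Ico_succ_bot (by omega), add_right_comm, add_assoc]
    have h2 : a (b + 1) ≤ a b := ha (by omega)
    obtain ⟨i1, i2⟩ := ih (b + 1)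
    rw [h1]
    constructor
    · intro hb
      obtain ⟨j1, j2⟩ := i2 (by omega)
      rw [if_pos hb]
      constructor <;> linarith
    · intro hb
      obtain ⟨j1, j2⟩ := i1 (by omega)
      rw [if_neg (by omega)]
      constructor <;> linarith

/-- Either the loads are nearly balanced, or the machine with the heavier big jobs gets only the
smallest jobs it has to take. -/
lemma side_load_bounds {K N : ℕ} {T : Bool} {δ D : ℝ} {s : ℕ → ℝ} (hN : 2 * K ≤ N) (hδ : 0 ≤ δ)
    (hD : 0 ≤ D) (hs : Antitone s) (h0 : ∀ i, 0 ≤ s i) :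
    let S := ∑ i ∈ range N, if side K T (fillCount K δ D s) i = true then s i else 0
    let S' := ∑ i ∈ range N, if side K T (fillCount K δ D s) i = true then 0 else s i
    let E := 2 * s 0 + δ * ∑ i ∈ range N, s i + ∑ i ∈ Ico (2 * K) N, s i
    S' ≤ D + S + E ∧ (D + S ≤ S' + E ∨ S ≤ ∑ i ∈ Ico K N, s i) := by
  intro S S' E
  set b := fillCount K δ D s with hb
  have hbK : b ≤ K := fillCount_le _ _ _ _
  set a : ℕ → ℝ := fun i => max (s i - s (2 * K - 1 - i)) 0 with ha
  have haK : ∀ i, i < K → a i = s i - s (2 * K - 1 - i) := fun i hi =>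
    max_eq_left (sub_nonneg.2 (hs (by omega)))
  have ha0 : ∀ i, 0 ≤ a i := fun i => le_max_right _ _
  have has : ∀ i, a i ≤ s i := fun i => max_le (by linarith [h0 (2 * K - 1 - i)]) (h0 i)
  have haanti : Antitone a := by
    intro i j hij
    refine max_le_max ?_ le_rfl
    have h1 := hs hij
    have h2 : s (2 * K - 1 - i) ≤ s (2 * K - 1 - j) := hs (by omega)
    linarith
  set tail := ∑ i ∈ Ico (2 * K) N, s i with htail
  have htail0 : 0 ≤ tail := sum_nonneg fun i _ => h0 i
  set R := ∑ i ∈ Ico b K, (if i % 2 = 1 then a i else -a i) with hR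
  -- the difference of the two loads
  have hdiff : S - S' = R - ∑ i ∈ range b, a i + if T then tail else -tail := by
    have h1 : S - S' = ∑ i ∈ range N, if side K T b i = true then s i else - s i := by
      rw [← sum_sub_distrib]
      refine sum_congr rfl fun i _ => ?_
      split_ifs <;> ring
    have h2 : ∀ i ∈ range K, ((if side K T b i = true then s i else - s i) +
        if side K T b (2 * K - 1 - i) = true then s (2 * K - 1 - i) else - s (2 * K - 1 - i))
        = if side K T b i = true then a i else - a i := by
      intro i hi
      rw [side_mirror _ (mem_range.1 hi), haK i (mem_range.1 hi)]
      cases side K T b i <;> simp <;> ring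
    have h3 : ∑ i ∈ Ico (2 * K) N, (if side K T b i = true then s i else - s i)
        = if T then tail else -tail := by
      rw [sum_congr rfl fun i hi => by rw [side_of_le _ (mem_Ico.1 hi).1]]
      cases T <;> simp [htail]
    rw [h1, sum_range_eq_sum_mirror _ hN, ← sum_add_distrib, sum_congr rfl h2, h3,
      ← sum_range_add_sum_Ico _ hbK]
    have h4 : ∑ i ∈ range b, (if side K T b i = true then a i else - a i)
        = - ∑ i ∈ range b, a i := by
      rw [← sum_neg_distrib]
      refine sum_congr rfl fun i hi => ?_
      have hi' := mem_range.1 hi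
      rw [side_of_lt _ (by omega)]
      simp only [Bool.and_eq_true, decide_eq_true_eq]
      rw [if_neg (by omega)]
    have h5 : ∑ i ∈ Ico b K, (if side K T b i = true then a i else - a i) = R := by
      refine sum_congr rfl fun i hi => ?_
      have hi' := mem_Ico.1 hi
      rw [side_of_lt _ hi'.2]
      simp [hi'.1]
    rw [h4, h5]
    ring
  have hsum : S + S' = ∑ i ∈ range K, s i + ∑ i ∈ range K, s (2 * K - 1 - i) + tail := by
    rw [← sum_range_eq_sum_mirror _ hN, ← sum_add_distrib]
    refine sum_congr rfl fun i _ => ?_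
    split_ifs <;> ring
  have hasum : ∑ i ∈ range K, a i = ∑ i ∈ range K, s i - ∑ i ∈ range K, s (2 * K - 1 - i) := by
    rw [← sum_sub_distrib]
    exact sum_congr rfl fun i hi => haK i (mem_range.1 hi)
  have hhalf : ∑ i ∈ Ico K N, s i = ∑ i ∈ range K, s (2 * K - 1 - i) + tail := by
    have h1 := sum_range_add_sum_Ico s (show K ≤ N by omega)
    have h2 := sum_range_eq_sum_mirror s hN
    linarith
  have hRb : |R| ≤ a b := by
    have := alternating_sum_bounds haanti ha0 (K - b) b
    rw [show b + (K - b) = K by omega] at this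
    rw [abs_le]
    have h3 := ha0 b
    rcases Nat.mod_two_eq_zero_or_one b with h | h
    · have := this.2 h
      constructor <;> linarith
    · have := this.1 h
      constructor <;> linarith
  rw [abs_le] at hRb
  have hab : a b ≤ s 0 := (has b).trans (hs (Nat.zero_le b))
  have hPs : 0 ≤ δ * ∑ i ∈ range N, s i := mul_nonneg hδ (sum_nonneg fun i _ => h0 i)
  have hT : -tail ≤ (if T then tail else -tail) ∧ (if T then tail else -tail) ≤ tail := by
    cases T <;> simp <;> linarith
  have hlow : ∑ i ∈ range b, a i ≤ ∑ i ∈ range b, gain K δ s i := by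
    refine sum_le_sum fun i hi => ?_
    rw [haK i (by have := mem_range.1 hi; omega)]
    exact sub_mirror_le_gain h0 i
  have hs0 := h0 0
  have hgD : ∑ i ∈ range b, gain K δ s i ≤ D + s 0 := by
    rcases Nat.eq_zero_or_pos b with hz | hz
    · rw [hz]; simp; linarith
    · obtain ⟨c, hc⟩ : ∃ c, b = c + 1 := ⟨b - 1, by omega⟩
      have h1 := lt_fillCount (K := K) (δ := δ) (D := D) (s := s) (c := c) (by omega)
      rw [hc, sum_range_succ]
      have h2 := (gain_nonneg_le (δ := δ) hs h0 h1.1).2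
      have h3 : s c ≤ s 0 := hs (Nat.zero_le c)
      linarith [h1.2.1]
  refine ⟨by simp only [E]; linarith, ?_⟩
  by_cases hcase : D ≤ ∑ i ∈ range b, gain K δ s i
  · left
    have h1 : ∑ i ∈ range b, gain K δ s i ≤ ∑ i ∈ range b, a i + δ * ∑ i ∈ range N, s i := by
      have h2 : ∑ i ∈ range b, gain K δ s i ≤ ∑ i ∈ range b, (a i + δ * s i) := by
        refine sum_le_sum fun i hi => ?_
        rw [haK i (by have := mem_range.1 hi; omega)]
        exact gain_le_sub_mirror hδ h0 i
      rw [sum_add_distrib, ← mul_sum] at h2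
      have h3 : ∑ i ∈ range b, s i ≤ ∑ i ∈ range N, s i :=
        sum_le_sum_of_subset_of_nonneg (range_subset_range.2 (by omega)) fun i _ _ => h0 i
      nlinarith
    simp only [E]
    linarith
  · right
    have hrest : ∑ i ∈ Ico b K, a i = 0 := by
      rcases fillCount_spec K δ D s with h | h | h
      · rw [Ico_eq_empty (by omega), sum_empty]
      · exact absurd h hcase
      · rcases hbK.lt_or_eq with hlt | heq
        · have hm := mirror_eq_of_gain_eq_zero hs h0 (by omega) h
          refine sum_eq_zero fun i hi => ?_
          have hi' := mem_Ico.1 hi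
          refine le_antisymm ((haanti hi'.1).trans ?_) (ha0 i)
          rw [haK b hlt, hm, sub_self]
        · rw [heq, Ico_self, sum_empty]
    have hR0 : R ≤ 0 := by
      rw [← hrest]
      refine sum_le_sum fun i _ => ?_
      split_ifs
      · exact le_rfl
      · linarith [ha0 i]
    have h1 := sum_range_add_sum_Ico a hbK
    rw [hhalf]
    linarith
section Cascade

variable {J : Type*} [DecidableEq J] {N : ℕ}

/-- Enlarging the size of one job in a decreasing ordering of sizes: it suffices to move one job of
every size class in between. -/
lemma exists_cascade (x : ℝ) (t : J) : ∀ (a : ℕ) (e : Fin N ≃ J) (u : J → ℝ),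
    (e.symm t).1 = a → Antitone (u ∘ e) → u t ≤ x →
    (∀ i, i < e.symm t → u t < u (e i)) →
    ∃ e' : Fin N ≃ J, Antitone (Function.update u t x ∘ e') ∧
      Set.InjOn u {j | j ≠ t ∧ e'.symm j ≠ e.symm j} ∧
      (∀ j, j ≠ t → e'.symm j ≠ e.symm j → u t < u j ∧ u j < x) ∧
      (∀ i, u (e i) ≠ Function.update u t x (e' i) → i ≤ e.symm t ∧
        u (e i) ≤ Function.update u t x (e' i) ∧ Function.update u t x (e' i) ≤ x) ∧
      Set.InjOn (u ∘ e) {i | u (e i) ≠ Function.update u t x (e' i)} ∧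
      Set.InjOn (Function.update u t x ∘ e') {i | u (e i) ≠ Function.update u t x (e' i)} := by
  intro a
  induction a using Nat.strong_induction_on with
  | _ a ih =>
  intro e u hta hanti htx hfirst
  by_cases hcase : ∀ i, i < e.symm t → x ≤ u (e i)
  · have hval : ∀ i, i ≠ e.symm t → Function.update u t x (e i) = u (e i) := fun i hi =>
      Function.update_of_ne (fun h => hi (by rw [← h, e.symm_apply_apply])) _ _
    have hval' : Function.update u t x (e (e.symm t)) = x := by simp
    have hch : ∀ i, u (e i) ≠ Function.update u t x (e i) → i = e.symm t := fun i hi => by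
      by_contra h
      exact hi (hval i h).symm
    refine ⟨e, ?_, ?_, ?_, ?_, ?_, ?_⟩
    · intro i i' hii
      rcases eq_or_ne i (e.symm t) with rfl | hi
      · rcases eq_or_ne i' (e.symm t) with rfl | hi'
        · exact le_rfl
        · simp only [Function.comp_apply]
          rw [hval', hval i' hi']
          refine le_trans ?_ htx
          have := hanti hii
          simpa using this
      · rcases eq_or_ne i' (e.symm t) with rfl | hi'
        · simp only [Function.comp_apply]
          rw [hval', hval i hi]
          exact hcase i (lt_of_le_of_ne hii hi)
        · simp only [Function.comp_apply]
          rw [hval i hi, hval i' hi']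
          exact hanti hii
    · rintro j ⟨_, hj⟩; exact absurd rfl hj
    · intro j _ hj; exact absurd rfl hj
    · intro i hi
      obtain rfl := hch i hi
      rw [hval']
      exact ⟨le_rfl, by simpa using htx, le_rfl⟩
    · intro i hi i' hi' _
      rw [hch i hi, hch i' hi']
    · intro i hi i' hi' _
      rw [hch i hi, hch i' hi']
  · push Not at hcase
    obtain ⟨i₀, hi₀, hi₀x⟩ := hcase
    have ha0 : 0 < a := by rw [← hta]; exact lt_of_le_of_lt (Nat.zero_le _) hi₀
    set p : Fin N := ⟨a - 1, by have := (e.symm t).2; omega⟩ with hp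
    have hpt : p < e.symm t := by rw [Fin.lt_def]; simp only [hp]; omega
    set y := u (e p) with hy
    have hyx : y < x := lt_of_le_of_lt (hanti (show i₀ ≤ p by
      rw [Fin.le_def]; rw [Fin.lt_def] at hi₀; simp only [hp]; omega)) hi₀x
    have hty : u t < y := hfirst p hpt
    obtain ⟨a', ha'y, ha'min⟩ : ∃ a' : Fin N, u (e a') = y ∧ ∀ i < a', u (e i) ≠ y := by
      have hne : (univ.filter (fun i => u (e i) = y)).Nonempty := ⟨p, by simp [hy]⟩
      refine ⟨_, (mem_filter.1 (min'_mem _ hne)).2, fun i hi h => ?_⟩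
      exact absurd (min'_le _ i (by simpa using h)) (not_le.2 hi)
    have ha'p : a' ≤ p := by
      by_contra! h
      exact ha'min p h rfl
    have ha't : a' < e.symm t := ha'p.trans_lt hpt
    set e₁ : Fin N ≃ J := (Equiv.swap (e.symm t) a').trans e with he₁
    set u₁ := Function.update u t y with hu₁
    have hu₁' : Function.update u₁ t x = Function.update u t x := by rw [hu₁, Function.update_idem]
    have he₁t : e₁.symm t = a' := by simp [he₁]
    have hne_t : ∀ {i}, i ≠ e.symm t → e i ≠ t := fun {i} hi h => hi (by rw [← h, e.symm_apply_apply])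
    have hs₁t : u₁ (e₁ (e.symm t)) = y := by
      simp only [he₁, Equiv.trans_apply, Equiv.swap_apply_left, hu₁]
      rw [Function.update_of_ne (hne_t ha't.ne), ha'y]
    have hs₁ : ∀ i, i ≠ e.symm t → u₁ (e₁ i) = u (e i) := by
      intro i hi
      rcases eq_or_ne i a' with rfl | hi'
      · simp [he₁, hu₁, ha'y]
      · simp only [he₁, Equiv.trans_apply, Equiv.swap_apply_of_ne_of_ne hi hi', hu₁]
        rw [Function.update_of_ne (hne_t hi)]
    have hanti' : ∀ {i i'}, i ≤ i' → u (e i') ≤ u (e i) := fun {i i'} h => hanti h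
    have hanti₁ : Antitone (u₁ ∘ e₁) := by
      intro i i' hii
      simp only [Function.comp_apply]
      rcases eq_or_ne i (e.symm t) with rfl | hi
      · rcases eq_or_ne i' (e.symm t) with rfl | hi'
        · exact le_rfl
        · rw [hs₁t, hs₁ i' hi']
          have := hanti' hii
          rw [e.apply_symm_apply] at this
          linarith
      · rcases eq_or_ne i' (e.symm t) with rfl | hi'
        · rw [hs₁t, hs₁ i hi]
          refine hanti' ?_
          have := lt_of_le_of_ne hii hi
          rw [Fin.lt_def] at this
          rw [Fin.le_def]; simp only [hp]; omega
        · rw [hs₁ i hi, hs₁ i' hi']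
          exact hanti' hii
    obtain ⟨e', h1, h2, h3, h4, h5, h6⟩ := ih a'.1 (by rw [← hta]; exact ha't) e₁ u₁
      (by rw [he₁t]) hanti₁ (by simp [hu₁, hyx.le]) (by
        intro i hi
        rw [he₁t] at hi
        rw [hs₁ i (hi.trans ha't).ne, hu₁, Function.update_self]
        refine lt_of_le_of_ne ?_ (Ne.symm (ha'min i hi))
        rw [← ha'y]
        exact hanti' hi.le)
    rw [hu₁'] at h1 h4 h5 h6
    rw [he₁t] at h4
    have hu₁t : u₁ t = y := by simp [hu₁]
    have hu₁ne : ∀ {j}, j ≠ t → u₁ j = u j := fun {j} hj => Function.update_of_ne hj _ _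
    rw [hu₁t] at h3
    -- the moved jobs
    have hM : ∀ j, j ≠ t → e'.symm j ≠ e.symm j → j = e a' ∨ e'.symm j ≠ e₁.symm j := by
      intro j hj hj'
      by_cases hja : j = e a'
      · exact Or.inl hja
      · right
        have : e₁.symm j = e.symm j := by
          simp only [he₁, Equiv.symm_trans_apply, Equiv.symm_swap]
          exact Equiv.swap_apply_of_ne_of_ne (fun h => hj (e.symm.injective h))
            (fun h => hja (by rw [← h, e.apply_symm_apply]))
        rwa [this]
    have hM' : ∀ j, j ≠ t → e'.symm j ≠ e₁.symm j → y < u j ∧ u j < x := by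
      intro j hj hj'
      have := h3 j hj hj'
      rwa [hu₁ne hj] at this
    -- the changed positions
    have hC : ∀ i, u (e i) ≠ Function.update u t x (e' i) → i = e.symm t ∨
        (i ≠ e.symm t ∧ u₁ (e₁ i) ≠ Function.update u t x (e' i)) := by
      intro i hi
      by_cases h : i = e.symm t
      · exact Or.inl h
      · exact Or.inr ⟨h, by rwa [hs₁ i h]⟩
    have hC' : ∀ i, i ≠ e.symm t → u₁ (e₁ i) ≠ Function.update u t x (e' i) →
        i ≤ a' ∧ y ≤ u (e i) ∧ u (e i) < Function.update u t x (e' i) ∧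
          Function.update u t x (e' i) ≤ x := by
      intro i hi hi'
      obtain ⟨g1, g2, g3⟩ := h4 i hi'
      rw [hs₁ i hi] at g2 hi'
      exact ⟨g1, by rw [← ha'y]; exact hanti' g1, lt_of_le_of_ne g2 hi', g3⟩
    have hCt : Function.update u t x (e' (e.symm t)) = y := by
      by_contra h
      rw [← hs₁t] at h
      exact absurd (h4 _ (Ne.symm h)).1 (not_le.2 ha't)
    refine ⟨e', h1, ?_, ?_, ?_, ?_, ?_⟩
    · rintro j ⟨hj, hj'⟩ l ⟨hl, hl'⟩ hjl
      rcases hM j hj hj' with g | g <;> rcases hM l hl hl' with g' | g'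
      · rw [g, g']
      · have := (hM' l hl g').1
        rw [← hjl, g, ha'y] at this
        exact absurd this (lt_irrefl _)
      · have := (hM' j hj g).1
        rw [hjl, g', ha'y] at this
        exact absurd this (lt_irrefl _)
      · exact h2 ⟨hj, g⟩ ⟨hl, g'⟩ (by rw [hu₁ne hj, hu₁ne hl, hjl])
    · intro j hj hj'
      rcases hM j hj hj' with g | g
      · rw [g, ha'y]; exact ⟨hty, hyx⟩
      · have := hM' j hj g
        exact ⟨hty.trans this.1, this.2⟩
    · intro i hi
      rcases hC i hi with rfl | ⟨g, g'⟩
      · rw [hCt, e.apply_symm_apply]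
        exact ⟨le_rfl, hty.le, hyx.le⟩
      · have := hC' i g g'
        exact ⟨this.1.trans ha't.le, this.2.2.1.le, this.2.2.2⟩
    · intro i hi l hl hil
      simp only [Function.comp_apply] at hil
      rcases hC i hi with rfl | ⟨g1, g2⟩ <;> rcases hC l hl with rfl | ⟨g1', g2'⟩
      · rfl
      · have := (hC' l g1' g2').2.1
        rw [← hil, e.apply_symm_apply] at this
        linarith
      · have := (hC' i g1 g2).2.1
        rw [hil, e.apply_symm_apply] at this
        linarith
      · exact h5 g2 g2' (by simp only [Function.comp_apply]; rw [hs₁ i g1, hs₁ l g1', hil])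
    · intro i hi l hl hil
      simp only [Function.comp_apply] at hil
      rcases hC i hi with rfl | ⟨g1, g2⟩ <;> rcases hC l hl with rfl | ⟨g1', g2'⟩
      · rfl
      · have := hC' l g1' g2'
        rw [hCt] at hil
        linarith
      · have := hC' i g1 g2
        rw [hCt] at hil
        linarith
      · exact h6 g2 g2' hil

end Cascade
/-- A finite sequence, continued by zeros. -/
def padSeq {N : ℕ} (f : Fin N → ℝ) : ℕ → ℝ := fun i => if h : i < N then f ⟨i, h⟩ else 0

section PadSeq

variable {N : ℕ} {f : Fin N → ℝ}

lemma padSeq_val (f : Fin N → ℝ) (i : Fin N) : padSeq f i.1 = f i := by simp [padSeq]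

lemma padSeq_nonneg (h0 : ∀ i, 0 ≤ f i) (i : ℕ) : 0 ≤ padSeq f i := by
  unfold padSeq
  split_ifs
  · exact h0 _
  · exact le_rfl

lemma padSeq_antitone (hf : Antitone f) (h0 : ∀ i, 0 ≤ f i) : Antitone (padSeq f) := by
  intro i j hij
  unfold padSeq
  split_ifs
  · exact hf (by simpa using hij)
  · omega
  · exact h0 _
  · exact le_rfl

lemma padSeq_separated {q : ℝ} (h0 : ∀ i, 0 ≤ f i) (hsep : ∀ i j, f i < f j → q * f i ≤ f j)
    (i j : ℕ) (hij : padSeq f i < padSeq f j) : q * padSeq f i ≤ padSeq f j := by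
  unfold padSeq at hij ⊢
  split_ifs at hij ⊢
  · exact hsep _ _ hij
  · exact absurd hij (not_lt.2 (h0 _))
  · simpa using h0 _
  · simp

lemma lt_of_padSeq_ne {g : Fin N → ℝ} {i : ℕ} (h : padSeq f i ≠ padSeq g i) : i < N := by
  by_contra hi
  exact h (by simp [padSeq, hi])

lemma injOn_padSeq {g h : Fin N → ℝ} (hf : Set.InjOn f {i | g i ≠ h i}) :
    Set.InjOn (padSeq f) {i | padSeq g i ≠ padSeq h i} := by
  intro i hi j hj hij
  have hiN := lt_of_padSeq_ne hi
  have hjN := lt_of_padSeq_ne hj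
  simp only [Set.mem_ofPred_eq, padSeq, hiN, hjN, dif_pos] at hi hj hij
  exact congrArg Fin.val (hf hi hj hij)

end PadSeq

/-- The jobs that change sides have small total size if the fill counts come from decreasing
sequences that differ in few positions. -/
lemma exists_sum_side_ne_le {K N : ℕ} {T : Bool} {δ D q X : ℝ} {s s' : ℕ → ℝ} (hN : 2 * K ≤ N)
    (hq : 1 < q) (hδ : 0 < δ) (hδ1 : δ ≤ 1) (hX : 0 ≤ X) (hs : Antitone s) (hs' : Antitone s')
    (h0 : ∀ i, 0 ≤ s i) (h0' : ∀ i, 0 ≤ s' i) (hsep : ∀ i j, s i < s j → q * s i ≤ s j)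
    (hsep' : ∀ i j, s' i < s' j → q * s' i ≤ s' j)
    (hinj : Set.InjOn s {i | s i ≠ s' i}) (hinj' : Set.InjOn s' {i | s i ≠ s' i})
    (hle : ∀ i, s i ≠ s' i → s i ≤ X ∧ s' i ≤ X) :
    ∃ w : ℕ → ℝ, (w = s ∨ w = s') ∧
      ∑ i ∈ (range N).filter (fun i => side K T (fillCount K δ D s) i ≠
        side K T (fillCount K δ D s') i), w i ≤ 2 * (X / δ + 2 * X * (q / (q - 1)) ^ 2) := by
  rcases lt_trichotomy (fillCount K δ D s) (fillCount K δ D s') with h | h | h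
  · refine ⟨s', Or.inr rfl, ?_⟩
    have h1 := sum_Ico_fillCount_le hq hδ hδ1 hX hs hs' h0 h0' hsep hsep' hinj hinj' hle h
    have h2 := sum_side_ne_le (T := T) hs' h0' h.le (fillCount_le _ _ _ _) hN
    linarith
  · refine ⟨s, Or.inl rfl, ?_⟩
    simp only [h, ne_eq, not_true_eq_false, filter_false, sum_empty]
    have : 0 ≤ X / δ := div_nonneg hX hδ.le
    positivity
  · refine ⟨s, Or.inl rfl, ?_⟩
    have hset : {i | s' i ≠ s i} = {i | s i ≠ s' i} := by ext; simp [ne_comm]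
    have h1 := sum_Ico_fillCount_le hq hδ hδ1 hX hs' hs h0' h0 hsep' hsep (by rwa [hset])
      (by rwa [hset]) (fun i hi => (hle i hi.symm).symm) h
    have h2 := sum_side_ne_le (T := T) hs h0 h.le (fillCount_le _ _ _ _) hN
    simp only [ne_comm] at h2 ⊢
    linarith

section Relocate

variable {J : Type*} [Fintype J] [DecidableEq J] {N : ℕ}

/-- Enlarging a job of size zero in a decreasing ordering changes the sides of jobs of small total
size. -/
lemma exists_relocation {K : ℕ} {T : Bool} {δ D q x : ℝ} (hN : 2 * K ≤ N) (hq : 1 < q)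
    (hδ : 0 < δ) (hδ1 : δ ≤ 1) (hx : 0 ≤ x) (e : Fin N ≃ J) {u : J → ℝ} (hu : ∀ j, 0 ≤ u j)
    {t : J} (hut : u t = 0) (hsep : ∀ i j, u i < u j → q * u i ≤ u j)
    (hsep' : ∀ i j, Function.update u t x i < Function.update u t x j →
      q * Function.update u t x i ≤ Function.update u t x j) (he : Antitone (u ∘ e)) :
    ∃ e' : Fin N ≃ J, Antitone (Function.update u t x ∘ e') ∧
      ∑ j ∈ univ.filter (fun j => side K T (fillCount K δ D (padSeq (u ∘ e))) (e.symm j) ≠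
        side K T (fillCount K δ D (padSeq (Function.update u t x ∘ e'))) (e'.symm j)), u j
      ≤ q / (q - 1) * x + 2 * (x / δ + 2 * x * (q / (q - 1)) ^ 2) := by
  obtain ⟨z, hz, hzmin⟩ : ∃ z : Fin N, u (e z) = 0 ∧ ∀ i < z, u (e i) ≠ 0 := by
    have hne : (univ.filter (fun i => u (e i) = 0)).Nonempty := ⟨e.symm t, by simp [hut]⟩
    refine ⟨_, (mem_filter.1 (min'_mem _ hne)).2, fun i hi h => ?_⟩
    exact absurd (min'_le _ i (by simpa using h)) (not_le.2 hi)
  set e₀ : Fin N ≃ J := (Equiv.swap z (e.symm t)).trans e with he₀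
  have hue : u ∘ e₀ = u ∘ e := by
    ext i
    simp only [he₀, Function.comp_apply, Equiv.trans_apply]
    rcases eq_or_ne i z with rfl | h
    · simp [hz, hut]
    · rcases eq_or_ne i (e.symm t) with rfl | h'
      · simp [hz, hut]
      · rw [Equiv.swap_apply_of_ne_of_ne h h']
  have he₀t : e₀.symm t = z := by simp [he₀]
  have he₀symm : ∀ j, u j ≠ 0 → e₀.symm j = e.symm j := by
    intro j hj
    simp only [he₀, Equiv.symm_trans_apply, Equiv.symm_swap]
    refine Equiv.swap_apply_of_ne_of_ne (fun h => hj ?_) (fun h => hj ?_)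
    · rw [← hz, ← h, e.apply_symm_apply]
    · rw [e.symm.injective h, hut]
  have hue' : ∀ i, u (e₀ i) = u (e i) := fun i => congrFun hue i
  obtain ⟨e', h1, h2, h3, h4, h5, h6⟩ := exists_cascade x t z.1 e₀ u (by rw [he₀t])
    (by rw [hue]; exact he) (by rw [hut]; exact hx) (by
      intro i hi
      rw [he₀t] at hi
      rw [hut, hue']
      exact lt_of_le_of_ne (hu _) (hzmin i hi).symm)
  rw [hut] at h3
  simp only [hue'] at h4 h5 h6
  rw [hue] at h5
  set u' := Function.update u t x with hu'
  have hu'0 : ∀ j, 0 ≤ u' j := by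
    intro j
    rcases eq_or_ne j t with rfl | h
    · simpa [hu'] using hx
    · simpa [hu', h] using hu j
  refine ⟨e', h1, ?_⟩
  obtain ⟨w, hw, hsum⟩ := exists_sum_side_ne_le (K := K) (T := T) (D := D) (s := padSeq (u ∘ e))
    (s' := padSeq (u' ∘ e')) hN hq hδ hδ1 hx
    (padSeq_antitone he fun i => hu _) (padSeq_antitone h1 fun i => hu'0 _)
    (padSeq_nonneg fun i => hu _) (padSeq_nonneg fun i => hu'0 _)
    (padSeq_separated (fun i => hu _) fun i j => hsep _ _)
    (padSeq_separated (fun i => hu'0 _) fun i j => hsep' _ _)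
    (injOn_padSeq h5) (injOn_padSeq h6) (by
      intro i hi
      have hiN := lt_of_padSeq_ne hi
      simp only [padSeq, hiN, dif_pos, Function.comp_apply] at hi ⊢
      have := h4 _ hi
      exact ⟨this.2.1.trans this.2.2, this.2.2⟩)
  set b := fillCount K δ D (padSeq (u ∘ e))
  set b' := fillCount K δ D (padSeq (u' ∘ e'))
  set M := univ.filter (fun j => j ≠ t ∧ e'.symm j ≠ e₀.symm j)
  set A := univ.filter (fun j : J => j ≠ t ∧ e'.symm j = e₀.symm j ∧
    side K T b (e₀.symm j) ≠ side K T b' (e₀.symm j))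
  have hM : ∑ j ∈ M, u j ≤ q / (q - 1) * x := by
    have := sum_le_of_separated hq M (f := u) x hx
      (fun j hj => by
        have hj' := mem_filter.1 hj
        have := h3 j hj'.2.1 hj'.2.2
        exact ⟨this.1.le, this.2.le⟩)
      (fun i hi j hj => h2 (mem_filter.1 hi).2 (mem_filter.1 hj).2) (fun i _ j _ => hsep i j)
    rw [div_mul_eq_mul_div, le_div_iff₀ (by linarith)]
    linarith
  have hA : ∑ j ∈ A, u j ≤ ∑ i ∈ (range N).filter (fun i => side K T b i ≠ side K T b' i), w i := by
    have hval : ∀ j ∈ A, u j = w (e₀.symm j) := by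
      intro j hj
      obtain ⟨_, hjt, hje, -⟩ := mem_filter.1 hj
      rcases hw with rfl | rfl
      · rw [padSeq_val, Function.comp_apply, ← hue', e₀.apply_symm_apply]
      · rw [padSeq_val, Function.comp_apply, ← hje, e'.apply_symm_apply, hu',
          Function.update_of_ne hjt]
    rw [sum_congr rfl hval]
    rw [← sum_image (s := A) (g := fun j => (e₀.symm j).1) (f := w)
      (fun i _ j _ hij => e₀.symm.injective (Fin.ext hij))]
    refine sum_le_sum_of_subset_of_nonneg ?_ fun i _ _ => ?_
    · intro i hi
      obtain ⟨j, hj, rfl⟩ := mem_image.1 hi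
      exact mem_filter.2 ⟨mem_range.2 (e₀.symm j).2, (mem_filter.1 hj).2.2.2⟩
    · rcases hw with rfl | rfl
      · exact padSeq_nonneg (fun i => hu _) i
      · exact padSeq_nonneg (fun i => hu'0 _) i
  have hsub : ∑ j ∈ univ.filter (fun j => side K T b (e.symm j) ≠ side K T b' (e'.symm j)), u j
      ≤ ∑ j ∈ M ∪ A, u j := by
    rw [← sum_filter_ne_zero]
    refine sum_le_sum_of_subset_of_nonneg (fun j hj => ?_) fun j _ _ => hu j
    obtain ⟨hj, hj0⟩ := mem_filter.1 hj
    have hjt : j ≠ t := fun h => hj0 (by rw [h, hut])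
    have hj' := (mem_filter.1 hj).2
    rw [← he₀symm j hj0] at hj'
    by_cases h : e'.symm j = e₀.symm j
    · rw [h] at hj'
      exact mem_union_right _ (mem_filter.2 ⟨mem_univ _, hjt, h, hj'⟩)
    · exact mem_union_left _ (mem_filter.2 ⟨mem_univ _, hjt, h⟩)
  have hun : ∑ j ∈ M ∪ A, u j ≤ ∑ j ∈ M, u j + ∑ j ∈ A, u j := by
    rw [← sum_union_inter]
    have : 0 ≤ ∑ j ∈ M ∩ A, u j := sum_nonneg fun j _ => hu j
    linarith
  linarith

end Relocate

/-- `rnd` rounds nonnegative numbers down to powers of `q`. -/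
structure IsRounding (q : ℝ) (rnd : ℝ → ℝ) : Prop where
  zero : rnd 0 = 0
  nonneg : ∀ y, 0 ≤ rnd y
  le : ∀ y, 0 ≤ y → rnd y ≤ y
  le_mul : ∀ y, y ≤ q * rnd y
  separated : ∀ y z, rnd y < rnd z → q * rnd y ≤ rnd z

lemma exists_isRounding {q : ℝ} (hq : 1 < q) : ∃ rnd, IsRounding q rnd := by
  have hq0 : 0 < q := by linarith
  have h : ∀ y : ℝ, ∃ r : ℝ, (0 < y → ∃ n : ℤ, r = q ^ n ∧ q ^ n ≤ y ∧ y < q ^ (n + 1)) ∧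
      (y ≤ 0 → r = 0) := by
    intro y
    rcases lt_or_ge 0 y with hy | hy
    · obtain ⟨n, hn⟩ := exists_mem_Ico_zpow hy hq
      exact ⟨q ^ n, fun _ => ⟨n, rfl, hn.1, hn.2⟩, fun h => absurd h (not_le.2 hy)⟩
    · exact ⟨0, fun h => absurd h (not_lt.2 hy), fun _ => rfl⟩
  choose rnd hpos hzero using h
  refine ⟨rnd, hzero 0 le_rfl, fun y => ?_, fun y hy => ?_, fun y => ?_, fun y z hyz => ?_⟩
  · rcases lt_or_ge 0 y with hy | hy
    · obtain ⟨n, hn, -⟩ := hpos y hy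
      rw [hn]; positivity
    · exact (hzero y hy).ge
  · rcases hy.lt_or_eq with hy | rfl
    · obtain ⟨n, hn, h1, -⟩ := hpos y hy
      rwa [hn]
    · exact (hzero 0 le_rfl).le
  · rcases lt_or_ge 0 y with hy | hy
    · obtain ⟨n, hn, -, h2⟩ := hpos y hy
      rw [hn, mul_comm, ← zpow_add_one₀ hq0.ne']
      exact h2.le
    · rw [hzero y hy]; simpa using hy
  · rcases lt_or_ge 0 z with hz | hz
    · obtain ⟨n, hn, -⟩ := hpos z hz
      rcases lt_or_ge 0 y with hy | hy
      · obtain ⟨l, hl, -⟩ := hpos y hy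
        rw [hn, hl] at hyz ⊢
        rw [mul_comm, ← zpow_add_one₀ hq0.ne']
        exact zpow_le_zpow_right₀ hq.le ((zpow_lt_zpow_iff_right₀ hq).1 hyz)
      · rw [hzero y hy, hn]; simp; positivity
    · rw [hzero z hz] at hyz ⊢
      rcases lt_or_ge 0 y with hy | hy
      · obtain ⟨l, hl, -⟩ := hpos y hy
        rw [hl] at hyz
        exact absurd hyz (not_lt.2 (by positivity))
      · rw [hzero y hy] at hyz
        exact absurd hyz (lt_irrefl _)

section Packing

variable {k : ℕ}

/-- The load of machine `i` caused by the jobs in `H`. -/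
noncomputable def loadOn (H : Finset (Fin (2 * k))) (v : Fin (2 * k) → ℝ) (τ : Fin (2 * k) → Fin 2)
    (i : Fin 2) : ℝ :=
  ∑ j ∈ H.filter (fun j => τ j = i), v j

/-- The excess of the load of machine `m` over the load of the other machine, caused by the jobs in
`H`. -/
noncomputable def excess (H : Finset (Fin (2 * k))) (v : Fin (2 * k) → ℝ) (τ : Fin (2 * k) → Fin 2)
    (m : Fin 2) : ℝ :=
  ∑ j ∈ H, if τ j = m then v j else -v j

/-- The rounded sizes of the jobs outside `H` in the ordering `e`. -/
noncomputable def smallSeq (rnd : ℝ → ℝ) {N : ℕ} {H : Finset (Fin (2 * k))}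
    (v : Fin (2 * k) → ℝ) (e : Fin N ≃ {j // j ∉ H}) : ℕ → ℝ :=
  padSeq fun i => rnd (v (e i))

/-- The big jobs `H` are assigned optimally, the other ones according to `side`. -/
structure IsPacking (rnd : ℝ → ℝ) (θ δ : ℝ) (v : Fin (2 * k) → ℝ) (τ : Fin (2 * k) → Fin 2)
    (H : Finset (Fin (2 * k))) (m : Fin 2) (K N : ℕ) (T : Bool) (e : Fin N ≃ {j // j ∉ H}) :
    Prop where
  card_big : H.card * θ ≤ 1
  big_pos : ∀ j ∈ H, 0 < v j
  small_le : ∀ j ∉ H, v j ≤ θ * ∑ j, v j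
  excess_nonneg : 0 ≤ excess H v τ m
  optimal : ∀ ρ, ∃ i, loadOn H v τ m ≤ loadOn H v ρ i
  antitone : Antitone fun i => rnd (v (e i))
  two_mul_le : 2 * K ≤ N
  le_add_card : k ≤ K + H.card
  card_add : (H.filter fun j => τ j = m).card + K + (if T then N - 2 * K else 0) = k
  side_iff : ∀ i, τ (e i) = m ↔
    side K T (fillCount K δ (excess H v τ m) (smallSeq rnd v e)) i.1 = true

lemma loadOn_congr {H : Finset (Fin (2 * k))} {v v' : Fin (2 * k) → ℝ} {τ τ' : Fin (2 * k) → Fin 2}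
    (hv : ∀ j ∈ H, v j = v' j) (hτ : ∀ j ∈ H, τ j = τ' j) (i : Fin 2) :
    loadOn H v τ i = loadOn H v' τ' i := by
  rw [loadOn, loadOn, sum_filter, sum_filter]
  exact sum_congr rfl fun j hj => by rw [hv j hj, hτ j hj]

lemma excess_congr {H : Finset (Fin (2 * k))} {v v' : Fin (2 * k) → ℝ} {τ τ' : Fin (2 * k) → Fin 2}
    (hv : ∀ j ∈ H, v j = v' j) (hτ : ∀ j ∈ H, τ j = τ' j) (m : Fin 2) :
    excess H v τ m = excess H v' τ' m :=
  sum_congr rfl fun j hj => by rw [hv j hj, hτ j hj]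

lemma eq_add_one_iff_ne (m i : Fin 2) : i = m + 1 ↔ i ≠ m := by omega

lemma excess_eq (H : Finset (Fin (2 * k))) (v : Fin (2 * k) → ℝ) (τ : Fin (2 * k) → Fin 2)
    (m : Fin 2) : excess H v τ m = loadOn H v τ m - loadOn H v τ (m + 1) := by
  rw [loadOn, loadOn, sum_filter, sum_filter, excess, ← sum_sub_distrib]
  refine sum_congr rfl fun j _ => ?_
  by_cases h : τ j = m
  · have h' : m ≠ m + 1 := by omega
    simp [h]
  · simp [(eq_add_one_iff_ne m (τ j)).2 h]

lemma exists_optimal (H : Finset (Fin (2 * k))) (v : Fin (2 * k) → ℝ) :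
    ∃ (τ : Fin (2 * k) → Fin 2) (m : Fin 2), 0 ≤ excess H v τ m ∧
      ∀ ρ, ∃ i, loadOn H v τ m ≤ loadOn H v ρ i := by
  obtain ⟨τ, -, hτ⟩ := exists_min_image (univ : Finset (Fin (2 * k) → Fin 2))
    (fun ρ => max (loadOn H v ρ 0) (loadOn H v ρ 1)) univ_nonempty
  obtain ⟨m, -, hm⟩ := exists_max_image (univ : Finset (Fin 2)) (loadOn H v τ) univ_nonempty
  refine ⟨τ, m, ?_, fun ρ => ?_⟩
  · rw [excess_eq]
    linarith [hm (m + 1) (mem_univ _)]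
  · have h1 := hτ ρ (mem_univ _)
    have h2 : loadOn H v τ m ≤ max (loadOn H v τ 0) (loadOn H v τ 1) := by
      rcases (by omega : m = 0 ∨ m = 1) with rfl | rfl
      · exact le_max_left _ _
      · exact le_max_right _ _
    rcases le_max_iff.1 (h2.trans h1) with h | h
    · exact ⟨0, h⟩
    · exact ⟨1, h⟩

/-- An optimal assignment of the big jobs extends to a packing. -/
lemma exists_isPacking_extension {rnd : ℝ → ℝ} {θ δ : ℝ} {v : Fin (2 * k) → ℝ}
    {τ₀ : Fin (2 * k) → Fin 2} {H : Finset (Fin (2 * k))} {m : Fin 2} {K N : ℕ} {T : Bool}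
    {e : Fin N ≃ {j // j ∉ H}} (card_big : H.card * θ ≤ 1) (big_pos : ∀ j ∈ H, 0 < v j)
    (small_le : ∀ j ∉ H, v j ≤ θ * ∑ j, v j) (excess_nonneg : 0 ≤ excess H v τ₀ m)
    (optimal : ∀ ρ, ∃ i, loadOn H v τ₀ m ≤ loadOn H v ρ i)
    (antitone : Antitone fun i => rnd (v (e i))) (two_mul_le : 2 * K ≤ N)
    (le_add_card : k ≤ K + H.card)
    (card_add : (H.filter fun j => τ₀ j = m).card + K + (if T then N - 2 * K else 0) = k) :
    ∃ τ, IsPacking rnd θ δ v τ H m K N T e ∧ ∀ j ∈ H, τ j = τ₀ j := by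
  set b := fillCount K δ (excess H v τ₀ m) (smallSeq rnd v e) with hb
  set τ : Fin (2 * k) → Fin 2 := fun j =>
    if h : j ∉ H then (if side K T b (e.symm ⟨j, h⟩).1 = true then m else m + 1) else τ₀ j with hτ
  have hH : ∀ j ∈ H, τ j = τ₀ j := fun j hj => by simp [hτ, hj]
  have hex := excess_congr (v := v) (fun _ _ => rfl) hH m
  refine ⟨τ, ⟨card_big, big_pos, small_le, by rwa [hex], ?_, antitone, two_mul_le, le_add_card,
    ?_, ?_⟩, hH⟩
  · intro ρ
    rw [loadOn_congr (v := v) (fun _ _ => rfl) hH m]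
    exact optimal ρ
  · have h1 : H.filter (fun j => τ j = m) = H.filter (fun j => τ₀ j = m) :=
      filter_congr fun j hj => by rw [hH j hj]
    rw [h1]
    exact card_add
  · intro i
    rw [hex, ← hb]
    have h1 : τ (e i) = if side K T b i.1 = true then m else m + 1 := by
      simp [hτ, (e i).2]
    rw [h1]
    have h' : m + 1 ≠ m := by omega
    split_ifs with h <;> simp [h, h']

lemma exists_isPacking (rnd : ℝ → ℝ) {θ : ℝ} (δ : ℝ) (hθ : 0 < θ) (hk : 1 ≤ k * θ)
    {v : Fin (2 * k) → ℝ} (hv : 0 ≤ v) :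
    ∃ τ H m K N T, ∃ e : Fin N ≃ {j // j ∉ H}, IsPacking rnd θ δ v τ H m K N T e := by
  set P := ∑ j, v j with hP
  have hP0 : 0 ≤ P := sum_nonneg fun j _ => hv j
  set H := univ.filter (fun j => θ * P < v j) with hH
  have hpos : ∀ j ∈ H, 0 < v j := fun j hj =>
    lt_of_le_of_lt (by positivity) (mem_filter.1 hj).2
  have hHP : ∑ j ∈ H, v j ≤ P :=
    sum_le_sum_of_subset_of_nonneg (subset_univ _) fun j _ _ => hv j
  have hcard : H.card * θ ≤ 1 := by
    rcases H.eq_empty_or_nonempty with h | ⟨j, hj⟩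
    · simp [h]
    · have hPpos : 0 < P := (hpos j hj).trans_le (single_le_sum (fun j _ => hv j) (mem_univ j))
      have h1 : H.card • (θ * P) ≤ ∑ j ∈ H, v j :=
        card_nsmul_le_sum _ _ _ fun j hj => (mem_filter.1 hj).2.le
      rw [nsmul_eq_mul] at h1
      by_contra! h
      nlinarith
  have hHk : H.card ≤ k := by
    have : (H.card : ℝ) * θ ≤ k * θ := by linarith
    exact_mod_cast le_of_mul_le_mul_right this hθ
  obtain ⟨τ₀, m, hex, hopt⟩ := exists_optimal H v
  have hcN : Fintype.card {j // j ∉ H} = 2 * k - H.card := by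
    rw [Fintype.card_subtype_compl, Fintype.card_fin, Fintype.card_coe]
  set e₀ := (Fintype.equivFinOfCardEq hcN).symm
  set e := (Tuple.sort fun i => -rnd (v (e₀ i))).trans e₀ with he
  have hanti : Antitone fun i => rnd (v (e i)) := by
    intro i j hij
    have := Tuple.monotone_sort (fun i => -rnd (v (e₀ i))) hij
    simpa [he] using this
  set c := (H.filter fun j => τ₀ j = m).card with hc
  have hcH : c ≤ H.card := card_filter_le _ _
  by_cases hcase : c ≤ H.card - c
  · obtain ⟨τ, hτ, -⟩ := exists_isPacking_extension (δ := δ) (K := k - (H.card - c)) (T := true)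
      hcard hpos
      (fun j hj => not_lt.1 fun h => hj (mem_filter.2 ⟨mem_univ _, h⟩)) hex hopt hanti (by omega)
      (by omega) (by rw [← hc, if_pos rfl]; omega)
    exact ⟨_, _, _, _, _, _, _, hτ⟩
  · obtain ⟨τ, hτ, -⟩ := exists_isPacking_extension (δ := δ) (K := k - c) (T := false)
      hcard hpos
      (fun j hj => not_lt.1 fun h => hj (mem_filter.2 ⟨mem_univ _, h⟩)) hex hopt hanti (by omega)
      (by omega) (by rw [← hc, if_neg (by decide)]; omega)
    exact ⟨_, _, _, _, _, _, _, hτ⟩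

end Packing

section Step

variable {k : ℕ} {rnd : ℝ → ℝ} {θ δ q : ℝ} {v : Fin (2 * k) → ℝ} {τ : Fin (2 * k) → Fin 2}
  {H : Finset (Fin (2 * k))} {m : Fin 2} {K N : ℕ} {T : Bool} {e : Fin N ≃ {j // j ∉ H}}

lemma sum_update {n : ℕ} {v : Fin n → ℝ} {t : Fin n} (ht : v t = 0) (x : ℝ) :
    ∑ j, Function.update v t x j = ∑ j, v j + x := by
  rw [sum_update_of_mem (mem_univ t), add_comm, ← sum_sdiff (subset_univ {t}), sum_singleton, ht,
    add_zero]

/-- If the new job is small then the packing can be adapted with little migration. -/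
lemma IsPacking.exists_small_step (h : IsPacking rnd θ δ v τ H m K N T e) (hrnd : IsRounding q rnd)
    (hq : 1 < q) (hδ : 0 < δ) (hδ1 : δ ≤ 1) (hθ : 0 ≤ θ) (hv : 0 ≤ v) {t : Fin (2 * k)}
    (ht : v t = 0) {x : ℝ} (hx : 0 ≤ x) (hxP : x ≤ θ * (∑ j, v j + x)) :
    ∃ (τ' : Fin (2 * k) → Fin 2) (e' : Fin N ≃ {j // j ∉ H}),
      IsPacking rnd θ δ (Function.update v t x) τ' H m K N T e' ∧
      ∑ j ∈ univ.filter (fun j => τ' j ≠ τ j), v j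
        ≤ q * (q / (q - 1) * x + 2 * (x / δ + 2 * x * (q / (q - 1)) ^ 2)) := by
  have htH : t ∉ H := fun hmem => (h.big_pos t hmem).ne' ht
  set v' := Function.update v t x with hv'
  have hvH : ∀ j ∈ H, v' j = v j := fun j hj =>
    Function.update_of_ne (fun hjt : j = t => htH (hjt ▸ hj)) _ _
  set u : {j // j ∉ H} → ℝ := fun j => rnd (v j) with hu
  have hu' : Function.update u ⟨t, htH⟩ (rnd x) = fun j : {j // j ∉ H} => rnd (v' j) := by
    ext j
    rcases eq_or_ne j ⟨t, htH⟩ with rfl | hj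
    · simp [hv']
    · rw [Function.update_of_ne hj, hv', Function.update_of_ne fun hh => hj (Subtype.ext hh)]
  obtain ⟨e', he', hmove⟩ := exists_relocation (K := K) (T := T) (D := excess H v τ m)
    (x := rnd x) h.two_mul_le hq hδ hδ1 (hrnd.nonneg x) e (u := u) (fun j => hrnd.nonneg _)
    (t := ⟨t, htH⟩) (by simp only [hu]; rw [ht, hrnd.zero]) (fun i j => hrnd.separated _ _)
    (by rw [hu']; exact fun i j => hrnd.separated _ _) h.antitone
  rw [hu'] at he' hmove
  have hP : ∑ j, v' j = ∑ j, v j + x := sum_update ht x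
  have hexc : excess H v' τ m = excess H v τ m := excess_congr hvH (fun _ _ => rfl) m
  obtain ⟨τ', hτ', hττ⟩ := exists_isPacking_extension (rnd := rnd) (δ := δ) (v := v') (τ₀ := τ)
    (e := e') (K := K) (T := T) (m := m)
    h.card_big (fun j hj => by rw [hvH j hj]; exact h.big_pos j hj)
    (fun j hj => by
      rw [hP]
      rcases eq_or_ne j t with rfl | hjt
      · simpa [hv'] using hxP
      · rw [hv', Function.update_of_ne hjt]
        nlinarith [h.small_le j hj])
    (by rw [hexc]; exact h.excess_nonneg)
    (fun ρ => by
      obtain ⟨i, hi⟩ := h.optimal ρ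
      refine ⟨i, ?_⟩
      rwa [loadOn_congr hvH (fun _ _ => rfl), loadOn_congr hvH (fun _ _ => rfl)])
    he' h.two_mul_le h.le_add_card h.card_add
  refine ⟨τ', e', hτ', ?_⟩
  set S := univ.filter (fun j : {j // j ∉ H} =>
    side K T (fillCount K δ (excess H v τ m) (padSeq (u ∘ e))) (e.symm j) ≠
    side K T (fillCount K δ (excess H v τ m) (padSeq ((fun j : {j // j ∉ H} => rnd (v' j)) ∘ e'))) (e'.symm j))
  have hexc' : excess H v' τ' m = excess H v τ m := excess_congr hvH hττ m
  have hsub : univ.filter (fun j => τ' j ≠ τ j) ⊆ S.map (Function.Embedding.subtype _) := by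
    intro j hj
    have hj' := (mem_filter.1 hj).2
    have hjH : j ∉ H := fun hmem => hj' (hττ j hmem)
    refine mem_map.2 ⟨⟨j, hjH⟩, mem_filter.2 ⟨mem_univ _, fun hside => hj' ?_⟩, rfl⟩
    have h1 := h.side_iff (e.symm ⟨j, hjH⟩)
    have h2 := hτ'.side_iff (e'.symm ⟨j, hjH⟩)
    rw [Equiv.apply_symm_apply] at h1 h2
    rw [hexc'] at h2
    have h3 : τ j = m ↔ τ' j = m := by
      rw [h1, h2]
      exact Bool.eq_iff_iff.1 hside
    omega
  have hr : 0 ≤ q / (q - 1) := div_nonneg (by linarith) (by linarith)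
  calc ∑ j ∈ univ.filter (fun j => τ' j ≠ τ j), v j
      ≤ ∑ j ∈ S.map (Function.Embedding.subtype _), v j :=
        sum_le_sum_of_subset_of_nonneg hsub fun j _ _ => hv j
    _ = ∑ j ∈ S, v j := by rw [sum_map]; rfl
    _ ≤ ∑ j ∈ S, q * u j := sum_le_sum fun j _ => hrnd.le_mul _
    _ = q * ∑ j ∈ S, u j := by rw [mul_sum]
    _ ≤ q * (q / (q - 1) * rnd x + 2 * (rnd x / δ + 2 * rnd x * (q / (q - 1)) ^ 2)) :=
        mul_le_mul_of_nonneg_left hmove (by linarith)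
    _ ≤ q * (q / (q - 1) * x + 2 * (x / δ + 2 * x * (q / (q - 1)) ^ 2)) := by
        have := hrnd.le x hx
        gcongr

end Step

section Quality

variable {k : ℕ} {rnd : ℝ → ℝ} {θ δ q : ℝ} {v : Fin (2 * k) → ℝ} {τ : Fin (2 * k) → Fin 2}
  {H : Finset (Fin (2 * k))} {m : Fin 2} {K N : ℕ} {T : Bool} {e : Fin N ≃ {j // j ∉ H}}

lemma exists_packing_step {β : ℝ} (h : IsPacking rnd θ δ v τ H m K N T e)
    (hrnd : IsRounding q rnd) (hq : 1 < q) (hδ : 0 < δ) (hδ1 : δ ≤ 1) (hθ : 0 < θ)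
    (hk : 1 ≤ k * θ) (hβ : 1 / θ ≤ β)
    (hβ' : q * (q / (q - 1) + 2 * (1 / δ + 2 * (q / (q - 1)) ^ 2)) ≤ β) (hv : 0 ≤ v)
    {t : Fin (2 * k)} (ht : v t = 0) {x : ℝ} (hx : 0 ≤ x) :
    ∃ (τ' : Fin (2 * k) → Fin 2),
      (∃ H m K N T, ∃ e : Fin N ≃ {j // j ∉ H},
        IsPacking rnd θ δ (Function.update v t x) τ' H m K N T e) ∧
      ∑ j ∈ univ.filter (fun j => τ' j ≠ τ j), v j ≤ β * x := by
  rcases le_total x (θ * (∑ j, v j + x)) with hxP | hxP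
  · obtain ⟨τ', e', hτ', hm⟩ := h.exists_small_step hrnd hq hδ hδ1 hθ.le hv ht hx hxP
    refine ⟨τ', ⟨_, _, _, _, _, _, hτ'⟩, hm.trans ?_⟩
    refine le_trans (le_of_eq ?_) (mul_le_mul_of_nonneg_right hβ' hx)
    ring
  · have hv' : 0 ≤ Function.update v t x := by
      intro j
      rcases eq_or_ne j t with rfl | hj
      · simpa using hx
      · rw [Function.update_of_ne hj]; exact hv j
    obtain ⟨τ', hτ'⟩ := exists_isPacking rnd δ hθ hk hv'
    refine ⟨τ', hτ', ?_⟩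
    calc ∑ j ∈ univ.filter (fun j => τ' j ≠ τ j), v j
        ≤ ∑ j, v j := sum_le_sum_of_subset_of_nonneg (subset_univ _) fun j _ _ => hv j
      _ ≤ 1 / θ * x := by
        rw [one_div_mul_eq_div, le_div_iff₀ hθ]
        nlinarith
      _ ≤ β * x := mul_le_mul_of_nonneg_right hβ hx

/-- Split a sum over the jobs of one machine into big jobs and positions of small jobs. -/
lemma sum_machine_eq (e : Fin N ≃ {j // j ∉ H}) (f : Fin (2 * k) → ℝ) (p : Fin (2 * k) → Prop)
    [DecidablePred p] :
    ∑ j ∈ univ.filter p, f j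
      = ∑ j ∈ H.filter p, f j + ∑ i : Fin N, if p (e i) then f (e i) else 0 := by
  rw [sum_filter, sum_filter, ← sum_add_sum_compl H]
  congr 1
  rw [e.sum_comp (fun j : {j // j ∉ H} => if p j then f j else 0)]
  exact (sum_subtype Hᶜ (fun j => mem_compl) (fun j => if p j then f j else 0))

lemma add_card_of_equiv (e : Fin N ≃ {j // j ∉ H}) : N + H.card = 2 * k := by
  have h1 := Fintype.card_congr e
  rw [Fintype.card_subtype_compl, Fintype.card_fin, Fintype.card_fin, Fintype.card_coe] at h1
  have h2 : H.card ≤ 2 * k := by simpa using card_le_univ H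
  omega

lemma IsPacking.card_eq (h : IsPacking rnd θ δ v τ H m K N T e) (i : Fin 2) :
    (univ.filter (fun j => τ j = i)).card = k := by
  have hm : (univ.filter (fun j => τ j = m)).card = k := by
    have h1 := sum_machine_eq e (fun _ => 1) (fun j => τ j = m)
    have h2 := card_side (K := K) (T := T)
      (fillCount K δ (excess H v τ m) (smallSeq rnd v e)) h.two_mul_le
    have h3 := h.card_add
    rw [add_assoc, ← h2] at h3
    refine Eq.trans ?_ h3
    simp only [h.side_iff] at h1
    rw [Fin.sum_univ_eq_sum_range (fun i => if side K T (fillCount K δ (excess H v τ m)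
      (smallSeq rnd v e)) i = true then (1 : ℝ) else 0) N, ← sum_filter] at h1
    simp only [sum_const, nsmul_eq_mul, mul_one] at h1
    exact_mod_cast h1
  rcases eq_or_ne i m with rfl | hi
  · exact hm
  · have h1 : univ.filter (fun j => τ j = i) = univ.filter (fun j => ¬ τ j = m) := by
      ext j
      simp only [mem_filter, mem_univ, true_and]
      omega
    have h2 := card_filter_add_card_filter_not (s := (univ : Finset (Fin (2 * k))))
      (fun j => τ j = m)
    rw [h1]
    simp only [card_univ, Fintype.card_fin] at h2
    omega

/-- The smallest values of a decreasing sequence come last. -/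
lemma sum_Ico_le_sum_of_card_le {s : ℕ → ℝ} (hs : Antitone s) (h0 : ∀ i, 0 ≤ s i) {a N : ℕ}
    {B : Finset ℕ} (hB : B ⊆ range N) (hc : N ≤ a + B.card) :
    ∑ i ∈ Ico a N, s i ≤ ∑ i ∈ B, s i := by
  have h1 : ∑ i ∈ Ico a N \ B, s i ≤ ∑ i ∈ B \ Ico a N, s i := by
    have hcard : (Ico a N \ B).card ≤ (B \ Ico a N).card := by
      rw [← card_sdiff_add_card_inter B (Ico a N)] at hc
      have := card_sdiff_add_card_inter (Ico a N) B
      rw [inter_comm, Nat.card_Ico] at this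
      omega
    have h2 : ∑ i ∈ Ico a N \ B, s i ≤ (Ico a N \ B).card • s a :=
      sum_le_card_nsmul _ _ _ fun i hi => hs (mem_Ico.1 (mem_sdiff.1 hi).1).1
    have h3 : (B \ Ico a N).card • s a ≤ ∑ i ∈ B \ Ico a N, s i :=
      card_nsmul_le_sum _ _ _ fun i hi => hs (by
        have hi' := mem_sdiff.1 hi
        have := mem_range.1 (hB hi'.1)
        have := hi'.2
        rw [mem_Ico] at this
        omega)
    exact h2.trans ((nsmul_le_nsmul_left (h0 a) hcard).trans h3)
  rw [← sum_inter_add_sum_sdiff (Ico a N) B, ← sum_inter_add_sum_sdiff B (Ico a N), inter_comm]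
  linarith

lemma sum_Ico_le_of_card_le {s : ℕ → ℝ} (hs : Antitone s) (h0 : ∀ i, 0 ≤ s i) {κ P : ℝ}
    (hκ : 0 ≤ κ) {K a b : ℕ} (ha : K ≤ a) (hab : ((b - a : ℕ) : ℝ) ≤ κ * K)
    (hP : ∑ i ∈ range K, s i ≤ P) : ∑ i ∈ Ico a b, s i ≤ κ * P := by
  have h1 : ∑ i ∈ Ico a b, s i ≤ (Ico a b).card • s K :=
    sum_le_card_nsmul _ _ _ fun i hi => hs (ha.trans (mem_Ico.1 hi).1)
  have h2 : (range K).card • s K ≤ ∑ i ∈ range K, s i :=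
    card_nsmul_le_sum _ _ _ fun i hi => hs (mem_range.1 hi).le
  rw [Nat.card_Ico, nsmul_eq_mul] at h1
  rw [card_range, nsmul_eq_mul] at h2
  have h3 := mul_le_mul_of_nonneg_right hab (h0 K)
  have h4 := mul_le_mul_of_nonneg_left (h2.trans hP) hκ
  linarith

end Quality

section LoadBound

variable {k : ℕ} {rnd : ℝ → ℝ} {θ δ q : ℝ} {v : Fin (2 * k) → ℝ} {τ : Fin (2 * k) → Fin 2}
  {H : Finset (Fin (2 * k))} {m : Fin 2} {K N : ℕ} {T : Bool} {e : Fin N ≃ {j // j ∉ H}}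

lemma machineLoad_add_machineLoad {n : ℕ} (v : Fin n → ℝ) (ρ : Fin n → Fin 2) (m : Fin 2) :
    machineLoad v ρ m + machineLoad v ρ (m + 1) = ∑ j, v j := by
  rw [machineLoad, machineLoad, ← sum_filter_add_sum_filter_not univ (fun j => ρ j = m) v]
  simp only [eq_add_one_iff_ne, ne_eq]

/-- A balanced schedule has a machine that gets at least the smallest jobs besides an optimal load
of big jobs. -/
lemma IsPacking.exists_le_machineLoad (h : IsPacking rnd θ δ v τ H m K N T e)
    (hrnd : IsRounding q rnd) (hv : 0 ≤ v) {ρ : Fin (2 * k) → Fin 2}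
    (hρ : ∀ i, (univ.filter (fun j => ρ j = i)).card = k) :
    ∃ i, loadOn H v τ m + ∑ i ∈ Ico k N, smallSeq rnd v e i ≤ machineLoad v ρ i := by
  obtain ⟨i, hi⟩ := h.optimal ρ
  refine ⟨i, ?_⟩
  have hsplit := sum_machine_eq e v (fun j => ρ j = i)
  set B : Finset ℕ := (univ.filter (fun l : Fin N => ρ (e l) = i)).map Fin.valEmbedding with hB
  have hBN : B ⊆ range N := by
    intro l hl
    obtain ⟨l', -, rfl⟩ := mem_map.1 hl
    exact mem_range.2 l'.2
  have hBc : N ≤ k + B.card := by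
    have h1 := sum_machine_eq e (fun _ => 1) (fun j => ρ j = i)
    rw [← sum_filter] at h1
    simp only [sum_const, nsmul_eq_mul, mul_one] at h1
    rw [hρ i] at h1
    have h1' : k = (H.filter fun j => ρ j = i).card
      + (univ.filter (fun l : Fin N => ρ (e l) = i)).card := by exact_mod_cast h1
    have h2 := add_card_of_equiv e
    have h3 := card_filter_le H (fun j => ρ j = i)
    rw [hB, card_map]
    omega
  have hs : ∀ i, 0 ≤ rnd (v (e i)) := fun i => hrnd.nonneg _
  have h1 := sum_Ico_le_sum_of_card_le (padSeq_antitone h.antitone hs) (padSeq_nonneg hs) hBN hBc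
  have h2 : ∑ l ∈ B, smallSeq rnd v e l ≤ ∑ l : Fin N, if ρ (e l) = i then v (e l) else 0 := by
    rw [hB, sum_map, ← sum_filter]
    refine sum_le_sum fun l _ => ?_
    rw [Fin.valEmbedding_apply, smallSeq, padSeq_val]
    exact hrnd.le _ (hv _)
  rw [machineLoad, hsplit]
  exact add_le_add hi (h1.trans h2)

/-- A packing is nearly optimal among the balanced schedules. -/
lemma IsPacking.machineLoad_le (h : IsPacking rnd θ δ v τ H m K N T e) (hrnd : IsRounding q rnd)
    (hq : 1 ≤ q) (hδ : 0 ≤ δ) (hθ : 0 ≤ θ) {κ : ℝ} (hκ0 : 0 ≤ κ) (hκ1 : κ ≤ 1) (hκ : H.card ≤ κ * K)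
    (hv : 0 ≤ v) {ρ : Fin (2 * k) → Fin 2}
    (hρ : ∀ i, (univ.filter (fun j => ρ j = i)).card = k) (i : Fin 2) :
    ∃ i', machineLoad v τ i ≤ machineLoad v ρ i' + (2 * θ + δ + κ + (q - 1)) * ∑ j, v j := by
  set P := ∑ j, v j with hP
  have hP0 : 0 ≤ P := sum_nonneg fun j _ => hv j
  set w : ℕ → ℝ := padSeq fun i => v (e i) with hw
  set s : ℕ → ℝ := smallSeq rnd v e with hs
  have hs0 : ∀ i, 0 ≤ s i := padSeq_nonneg fun i => hrnd.nonneg _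
  have hw0 : ∀ i, 0 ≤ w i := padSeq_nonneg fun i => hv _
  have hsanti : Antitone s := padSeq_antitone h.antitone fun i => hrnd.nonneg _
  have hsw : ∀ i, s i ≤ w i ∧ w i ≤ q * s i := by
    intro i
    simp only [hs, hw, smallSeq, padSeq]
    split_ifs
    · exact ⟨hrnd.le _ (hv _), hrnd.le_mul _⟩
    · simp
  set D := excess H v τ m with hD
  set b := fillCount K δ D s with hb
  set W := ∑ i ∈ range N, if side K T b i = true then w i else 0 with hW
  set W' := ∑ i ∈ range N, if side K T b i = true then 0 else w i with hW'
  obtain ⟨hbal1, hbal2⟩ := side_load_bounds (T := T) h.two_mul_le hδ h.excess_nonneg hsanti hs0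
  set S := ∑ i ∈ range N, if side K T b i = true then s i else 0 with hS
  set S' := ∑ i ∈ range N, if side K T b i = true then 0 else s i with hS'
  have hLm : machineLoad v τ m = loadOn H v τ m + W := by
    rw [machineLoad, sum_machine_eq e v (fun j => τ j = m), loadOn, hW,
      ← Fin.sum_univ_eq_sum_range (fun i => if side K T b i = true then w i else 0) N]
    simp only [h.side_iff, hw, padSeq_val]
    rfl
  have hLo : machineLoad v τ (m + 1) = loadOn H v τ (m + 1) + W' := by
    rw [machineLoad, sum_machine_eq e v (fun j => τ j = m + 1), loadOn, hW',
      ← Fin.sum_univ_eq_sum_range (fun i => if side K T b i = true then 0 else w i) N]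
    simp only [eq_add_one_iff_ne, ne_eq, h.side_iff, hw, padSeq_val, ite_not]
    rfl
  have hsum := machineLoad_add_machineLoad v τ m
  have hsumρ := machineLoad_add_machineLoad v ρ m
  rw [← hP] at hsum hsumρ
  have hm0 : ∀ i, 0 ≤ loadOn H v τ i := fun i => sum_nonneg fun j _ => hv j
  have hWW : W + W' = ∑ i ∈ range N, w i := by
    rw [hW, hW', ← sum_add_distrib]
    exact sum_congr rfl fun i _ => by split_ifs <;> simp
  have hwP : ∑ i ∈ range N, w i ≤ P := by linarith [hm0 m, hm0 (m + 1)]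
  have hsP : ∑ i ∈ range N, s i ≤ P := (sum_le_sum fun i _ => (hsw i).1).trans hwP
  have hqP : ∑ i ∈ range N, (q - 1) * s i ≤ (q - 1) * P := by
    rw [← mul_sum]
    exact mul_le_mul_of_nonneg_left hsP (by linarith)
  have hWS : W ≤ S + (q - 1) * P := by
    refine le_trans ?_ (add_le_add_right hqP S)
    rw [hW, hS, ← sum_add_distrib]
    refine sum_le_sum fun i _ => ?_
    have h1 := mul_nonneg (sub_nonneg.2 hq) (hs0 i)
    split_ifs
    · linarith [(hsw i).2]
    · linarith
  have hWS' : W' ≤ S' + (q - 1) * P := by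
    refine le_trans ?_ (add_le_add_right hqP S')
    rw [hW', hS', ← sum_add_distrib]
    refine sum_le_sum fun i _ => ?_
    have h1 := mul_nonneg (sub_nonneg.2 hq) (hs0 i)
    split_ifs
    · linarith
    · linarith [(hsw i).2]
  have hSW : S ≤ W := sum_le_sum fun i _ => by
    split_ifs
    · exact (hsw i).1
    · exact le_rfl
  have hSW' : S' ≤ W' := sum_le_sum fun i _ => by
    split_ifs
    · exact le_rfl
    · exact (hsw i).1
  have hcard := add_card_of_equiv e
  have hKN := h.two_mul_le
  have hKk : K ≤ k := by omega
  have hkK := h.le_add_card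
  have hsK : ∑ i ∈ range K, s i ≤ P :=
    (sum_le_sum_of_subset_of_nonneg (range_subset_range.2 (by omega)) fun i _ _ => hs0 i).trans hsP
  have htail : ∑ i ∈ Ico (2 * K) N, s i ≤ κ * P :=
    sum_Ico_le_of_card_le hsanti hs0 hκ0 (by omega)
      (le_trans (Nat.cast_le.2 (by omega : N - 2 * K ≤ H.card)) hκ) hsK
  have hmid : ∑ i ∈ Ico K k, s i ≤ κ * P :=
    sum_Ico_le_of_card_le hsanti hs0 hκ0 le_rfl
      (le_trans (Nat.cast_le.2 (by omega : k - K ≤ H.card)) hκ) hsK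
  have hs0θ : s 0 ≤ θ * P := by
    simp only [hs, smallSeq, padSeq]
    split_ifs with hN
    · exact (hrnd.le _ (hv _)).trans (h.small_le _ (e ⟨0, hN⟩).2)
    · positivity
  have hδP : δ * ∑ i ∈ range N, s i ≤ δ * P := mul_le_mul_of_nonneg_left hsP hδ
  have hDeq := excess_eq H v τ m
  rw [← hD] at hDeq
  have hθP := mul_nonneg hθ hP0
  have hδP0 := mul_nonneg hδ hP0
  have hκP := mul_nonneg hκ0 hP0
  have hηP := mul_nonneg (sub_nonneg.2 hq) hP0
  have hexp : (2 * θ + δ + κ + (q - 1)) * P = 2 * (θ * P) + δ * P + κ * P + (q - 1) * P := by ring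
  have hHk : H.card ≤ K := by
    have : (H.card : ℝ) ≤ K := hκ.trans (mul_le_of_le_one_left (Nat.cast_nonneg K) hκ1)
    exact_mod_cast this
  rw [hexp]
  have hmax : ∀ L, 2 * L ≤ P + (2 * (θ * P) + δ * P + κ * P + (q - 1) * P) →
      ∃ i', L ≤ machineLoad v ρ i' + (2 * (θ * P) + δ * P + κ * P + (q - 1) * P) := by
    intro L hL
    rcases le_total (machineLoad v ρ m) (machineLoad v ρ (m + 1)) with hle | hle
    · exact ⟨m + 1, by linarith⟩
    · exact ⟨m, by linarith⟩
  by_cases him : i = m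
  · subst him
    rcases hbal2 with hb2 | hb2
    · refine hmax _ ?_
      linarith
    · obtain ⟨i', hi'⟩ := h.exists_le_machineLoad hrnd hv hρ
      refine ⟨i', ?_⟩
      have := sum_Ico_consecutive s hKk (by omega : k ≤ N)
      rw [← hs] at hi'
      linarith
  · have hi : i = m + 1 := (eq_add_one_iff_ne m i).2 him
    subst hi
    refine hmax _ ?_
    linarith

end LoadBound

section Main

variable {k : ℕ} {ε : ℝ}

lemma exists_le_mul_machineLoad {v : Fin (2 * k) → ℝ} (hε : 0 ≤ ε) {ρ : Fin (2 * k) → Fin 2}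
    {L : ℝ} {i : Fin 2} (h : L ≤ machineLoad v ρ i + ε / 2 * ∑ j, v j) :
    ∃ i', L ≤ (1 + ε) * machineLoad v ρ i' := by
  obtain ⟨m, -, hm⟩ := exists_max_image (univ : Finset (Fin 2)) (machineLoad v ρ) univ_nonempty
  refine ⟨m, ?_⟩
  have h1 := machineLoad_add_machineLoad v ρ m
  have h2 := hm (m + 1) (mem_univ _)
  have h3 := hm i (mem_univ _)
  nlinarith

lemma exists_robustAlg_of_large (hε : 0 < ε) (hε1 : ε < 1) (hk : 80 / ε ^ 2 ≤ k) :
    ∃ R : RobustAlg 2, IsRobust 2 k (10000 / ε ^ 5) R ∧ RobustCompetitive 2 k R (1 + ε) := by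
  have hq : 1 < 1 + ε / 16 := by linarith
  obtain ⟨rnd, hrnd⟩ := exists_isRounding hq
  have hkε : 80 ≤ k * ε ^ 2 := by rwa [div_le_iff₀ (by positivity)] at hk
  have hkθ : 1 ≤ k * (ε / 16) := by nlinarith [(Nat.cast_nonneg k : (0 : ℝ) ≤ k)]
  refine exists_robustAlg (by linarith) (fun v τ => ∃ H m K N T, ∃ e : Fin N ≃ {j // j ∉ H},
    IsPacking rnd (ε / 16) (ε / 16) v τ H m K N T e) ?_ ?_ ?_ ?_
  · exact exists_isPacking rnd _ (by positivity) hkθ le_rfl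
  · rintro v τ ⟨H, m, K, N, T, e, h⟩ i
    exact h.card_eq i
  · rintro v τ ⟨H, m, K, N, T, e, h⟩ hv ρ hρ i
    have hH := h.card_big
    have hkK : (k : ℝ) ≤ K + H.card := by exact_mod_cast h.le_add_card
    have hκ : H.card ≤ ε / 4 * K := by
      have h1 : 64 ≤ K * ε ^ 2 := by nlinarith
      have h2 : ε * (H.card : ℝ) ≤ ε * (ε / 4 * K) := by nlinarith
      exact le_of_mul_le_mul_left h2 hε
    obtain ⟨i', hi'⟩ := h.machineLoad_le hrnd hq.le (by positivity) (by positivity)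
      (by positivity : 0 ≤ ε / 4) (by linarith) hκ hv hρ i
    refine exists_le_mul_machineLoad hε.le (i := i') (hi'.trans_eq ?_)
    ring
  · rintro v τ t x hv ht hx ⟨H, m, K, N, T, e, h⟩
    have hpow : ∀ n ≤ 5, 1 / ε ^ n ≤ 1 / ε ^ 5 := fun n hn =>
      one_div_le_one_div_of_le (by positivity) (pow_le_pow_of_le_one hε.le hε1.le hn)
    have h1 : 1 / ε ≤ 1 / ε ^ 5 := by simpa using hpow 1 (by norm_num)
    have h2 := hpow 2 (by norm_num)
    have h0 : 1 ≤ 1 / ε ^ 5 := by simpa using hpow 0 (by norm_num)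
    have hE : 10000 / ε ^ 5 = 10000 * (1 / ε ^ 5) := by ring
    have hr : (1 + ε / 16) / (1 + ε / 16 - 1) = 1 + 16 * (1 / ε) := by
      rw [add_sub_cancel_left, add_div, div_self (by positivity), add_comm, one_div_div]
      ring
    have hr2 : (1 + 16 * (1 / ε)) ^ 2 = 1 + 32 * (1 / ε) + 256 * (1 / ε ^ 2) := by
      field_simp; ring
    have hd : 1 / (ε / 16) = 16 * (1 / ε) := by field_simp
    refine exists_packing_step h hrnd hq (by positivity) (by linarith) (by positivity) hkθ ?_ ?_
      hv ht hx
    · rw [hd, hE]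
      linarith
    · rw [hr, hr2, hd, hE]
      refine (mul_le_mul (show 1 + ε / 16 ≤ 2 by linarith) le_rfl (by positivity)
        (by norm_num)).trans ?_
      linarith

/-- There is a balanced schedule whose makespan is minimal among the balanced schedules. -/
lemma exists_optimal_balanced (v : Fin (2 * k) → ℝ) :
    ∃ τ : Fin (2 * k) → Fin 2, (∀ i, (univ.filter (fun j => τ j = i)).card = k) ∧
      ∀ ρ : Fin (2 * k) → Fin 2, (∀ i, (univ.filter (fun j => ρ j = i)).card = k) →
        ∀ i, ∃ i', machineLoad v τ i ≤ machineLoad v ρ i' := by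
  classical
  obtain ⟨τ₀, -, hτ₀⟩ := exists_balanced_extension (k := k) (t := 0) (Nat.zero_le _)
    (ρ := Fin.elim0) (fun i => by simp)
  obtain ⟨τ, hτ, hmin⟩ := exists_min_image
    (univ.filter fun ρ : Fin (2 * k) → Fin 2 => ∀ i, (univ.filter (fun j => ρ j = i)).card = k)
    (fun ρ => max (machineLoad v ρ 0) (machineLoad v ρ 1))
    ⟨τ₀, mem_filter.2 ⟨mem_univ _, hτ₀⟩⟩
  refine ⟨τ, (mem_filter.1 hτ).2, fun ρ hρ i => ?_⟩
  have h1 := hmin ρ (mem_filter.2 ⟨mem_univ _, hρ⟩)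
  have h2 : machineLoad v τ i ≤ max (machineLoad v τ 0) (machineLoad v τ 1) := by
    rcases (by omega : i = 0 ∨ i = 1) with rfl | rfl
    · exact le_max_left _ _
    · exact le_max_right _ _
  rcases le_max_iff.1 (h2.trans h1) with h | h
  · exact ⟨0, h⟩
  · exact ⟨1, h⟩

lemma exists_robustAlg_of_small (hε : 0 < ε) (hε1 : ε < 1) (hk : k < 80 / ε ^ 2) :
    ∃ R : RobustAlg 2, IsRobust 2 k (10000 / ε ^ 5) R ∧ RobustCompetitive 2 k R (1 + ε) := by
  set δ := ε ^ 3 / 320 with hδ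
  have hδ0 : 0 < δ := by positivity
  have hkε : k * ε ^ 2 < 80 := by rwa [lt_div_iff₀ (by positivity)] at hk
  have hkδ : 2 * k * δ ≤ ε / 2 := by
    rw [hδ]
    nlinarith
  have hβ : 1 / δ ≤ 10000 / ε ^ 5 := by
    rw [hδ, div_le_div_iff₀ (by positivity) (by positivity)]
    have : ε ^ 5 ≤ ε ^ 3 := pow_le_pow_of_le_one hε.le hε1.le (by norm_num)
    linarith [pow_pos hε 3]
  refine exists_robustAlg (by linarith) (fun v τ =>
    (∀ i, (univ.filter (fun j => τ j = i)).card = k) ∧ ∃ u : Fin (2 * k) → ℝ,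
      (∀ j, 0 ≤ u j ∧ u j ≤ v j ∧ v j - u j ≤ δ * ∑ j, v j) ∧
      ∀ ρ : Fin (2 * k) → Fin 2, (∀ i, (univ.filter (fun j => ρ j = i)).card = k) →
        ∀ i, ∃ i', machineLoad u τ i ≤ machineLoad u ρ i') ?_ ?_ ?_ ?_
  · obtain ⟨τ, hτ, hopt⟩ := exists_optimal_balanced (0 : Fin (2 * k) → ℝ)
    exact ⟨τ, hτ, 0, by simp, hopt⟩
  · exact fun v τ h => h.1
  · rintro v τ ⟨-, u, hu, hopt⟩ hv ρ hρ i
    obtain ⟨i', hi'⟩ := hopt ρ hρ i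
    have h1 : machineLoad u ρ i' ≤ machineLoad v ρ i' := sum_le_sum fun j _ => (hu j).2.1
    have h2 : machineLoad v τ i - machineLoad u τ i ≤ ∑ j, (v j - u j) := by
      rw [machineLoad, machineLoad, ← sum_sub_distrib]
      exact sum_le_sum_of_subset_of_nonneg (subset_univ _) fun j _ _ => sub_nonneg.2 (hu j).2.1
    have h3 : ∑ j, (v j - u j) ≤ (univ : Finset (Fin (2 * k))).card • (δ * ∑ j, v j) :=
      sum_le_card_nsmul _ _ _ fun j _ => (hu j).2.2
    rw [card_univ, Fintype.card_fin, nsmul_eq_mul] at h3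
    push_cast at h3
    have h4 := mul_le_mul_of_nonneg_right hkδ (sum_nonneg fun j _ => hv j : 0 ≤ ∑ j, v j)
    exact exists_le_mul_machineLoad hε.le (i := i') (by linarith)
  · rintro v τ t x hv ht hx ⟨hτ, u, hu, hopt⟩
    have hP := sum_update ht x
    rcases le_total x (δ * (∑ j, v j + x)) with hxP | hxP
    · refine ⟨τ, ⟨hτ, u, fun j => ?_, hopt⟩, ?_⟩
      · rw [hP]
        have := hu j
        rcases eq_or_ne j t with rfl | hj
        · rw [Function.update_self]
          rw [ht] at this
          exact ⟨this.1, by linarith, by linarith⟩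
        · rw [Function.update_of_ne hj]
          exact ⟨this.1, this.2.1, by nlinarith⟩
      · simp only [ne_eq, not_true_eq_false, filter_false, sum_empty]
        positivity
    · obtain ⟨τ', hτ', hopt'⟩ := exists_optimal_balanced (Function.update v t x)
      have hv' : 0 ≤ ∑ j, Function.update v t x j := by
        rw [hP]
        have : 0 ≤ ∑ j, v j := sum_nonneg fun j _ => hv j
        linarith
      refine ⟨τ', ⟨hτ', _, fun j => ⟨?_, le_rfl, ?_⟩, hopt'⟩, ?_⟩
      · rcases eq_or_ne j t with rfl | hj
        · rwa [Function.update_self]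
        · rw [Function.update_of_ne hj]
          exact hv j
      · rw [sub_self]
        positivity
      · calc ∑ j ∈ univ.filter (fun j => τ' j ≠ τ j), v j
            ≤ ∑ j, v j := sum_le_sum_of_subset_of_nonneg (subset_univ _) fun j _ _ => hv j
          _ ≤ 1 / δ * x := by
            rw [one_div_mul_eq_div, le_div_iff₀ hδ0]
            nlinarith
          _ ≤ 10000 / ε ^ 5 * x := mul_le_mul_of_nonneg_right hβ hx

end Main

/-- There is a constant `C > 0` such that for every `0 < ε < 1` and every integer
`k > 1/ε²` there is a robust algorithm for `m = 2` machines and cardinality bound `k` with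
migration factor at most `C/ε⁵` that is `(1+ε)`-competitive (robust FPTAS for two
machines). -/
theorem robust_fptas_two_machines :
    ∃ C : ℝ, 0 < C ∧
      ∀ ε : ℝ, 0 < ε → ε < 1 → ∀ k : ℕ, 1 / ε ^ 2 < (k : ℝ) →
        ∃ R : RobustAlg 2,
          IsRobust 2 k (C / ε ^ 5) R ∧ RobustCompetitive 2 k R (1 + ε) := by
  refine ⟨10000, by norm_num, fun ε hε hε1 k _ => ?_⟩
  rcases lt_or_ge (k : ℝ) (80 / ε ^ 2) with hk | hk
  · exact exists_robustAlg_of_small hε hε1 hk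
  · exact exists_robustAlg_of_large hε hε1 hk
end
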